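/- arXiv:1407.3312 — 9 statements merged into one kernel-verified Lean document; each statement's English description precedes it below -/
import Mathlib

section
/- For every integer n ≥ 0, the submonoid of T_n generated by the set of all idempotents of T_n equals {1} ∪ (T_n \ S_n), i.e. it consists of the identity map together with all non-bijective transformations of {1,...,n}; moreover this submonoid is already generated by the idempotents of rank n−1. -/
/-- The map sending `a` to `b` and fixing every other point. -/
def collapse {α : Type*} [DecidableEq α] (a b : α) : Function.End α :=
  Function.update id a b

/-- The submonoid generated by the maps moving exactly one point. -/
def collapseClosure (α : Type*) [DecidableEq α] : Submonoid (Function.End α) :=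
  Submonoid.closure {g | ∃ a b, a ≠ b ∧ g = collapse a b}

theorem collapse_mem_collapseClosure {α : Type*} [DecidableEq α] {a b : α} (hab : a ≠ b) :
    collapse a b ∈ collapseClosure α :=
  Submonoid.subset_closure ⟨a, b, hab, rfl⟩

theorem collapse_apply {α : Type*} [DecidableEq α] (a b x : α) :
    collapse a b x = if x = a then b else x := by
  simp [collapse, Function.update_apply]

theorem collapse_mul_self {α : Type*} [DecidableEq α] {a b : α} (hab : a ≠ b) :
    collapse a b * collapse a b = collapse a b := by
  funext x
  change collapse a b (collapse a b x) = collapse a b x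
  simp only [collapse_apply]
  grind

theorem range_collapse {α : Type*} [DecidableEq α] {a b : α} (hab : a ≠ b) :
    Set.range (collapse a b) = {a}ᶜ := by
  ext y
  constructor
  · rintro ⟨x, rfl⟩
    have := collapse_apply a b x
    simp only [Set.mem_compl_iff, Set.mem_singleton_iff]
    grind
  · intro hy
    exact ⟨y, (collapse_apply a b y).trans (if_neg hy)⟩

theorem swap_comp_mem_collapseClosure {α : Type*} [DecidableEq α] {f : Function.End α}
    (hf : f ∈ collapseClosure α)
    (hs : ¬ Function.Surjective f) {a b : α} (hab : a ≠ b) :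
    (Equiv.swap a b ∘ f : Function.End α) ∈ collapseClosure α := by
  have key : ∀ {x y : α} {g : Function.End α}, x ≠ y →
      g ∈ collapseClosure α →
      collapse x y * g ∈ collapseClosure α :=
    fun hxy hg => mul_mem (collapse_mem_collapseClosure hxy) hg
  obtain ⟨c, hc⟩ : ∃ c, ∀ x, f x ≠ c := by simpa [Function.Surjective] using hs
  by_cases hca : c = a
  · subst hca
    have h : (Equiv.swap c b ∘ f : Function.End α) = collapse b c * f := by
      funext x
      change Equiv.swap c b (f x) = collapse b c (f x)
      have := hc x
      simp only [collapse_apply, Equiv.swap_apply_def]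
      grind
    exact h ▸ key hab.symm hf
  by_cases hcb : c = b
  · subst hcb
    have h : (Equiv.swap a c ∘ f : Function.End α) = collapse a c * f := by
      funext x
      change Equiv.swap a c (f x) = collapse a c (f x)
      have := hc x
      simp only [collapse_apply, Equiv.swap_apply_def]
      grind
    exact h ▸ key hab hf
  have h : (Equiv.swap a b ∘ f : Function.End α) =
      collapse c b * (collapse b a * (collapse a c * f)) := by
    funext x
    change Equiv.swap a b (f x) = collapse c b (collapse b a (collapse a c (f x)))
    have := hc x
    simp only [collapse_apply, Equiv.swap_apply_def]
    grind
  exact h ▸ key hcb (key hab.symm (key (Ne.symm hca) hf))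

theorem perm_comp_mem_collapseClosure {α : Type*} [DecidableEq α] [Finite α]
    {f : Function.End α}
    (hf : f ∈ collapseClosure α)
    (hs : ¬ Function.Surjective f) (σ : Equiv.Perm α) :
    (σ ∘ f : Function.End α) ∈ collapseClosure α := by
  induction σ using Equiv.Perm.swap_induction_on with
  | one => exact hf
  | swap_mul σ x y hxy ih =>
    refine swap_comp_mem_collapseClosure ih (fun h => hs ?_) hxy
    exact (Function.Surjective.of_comp_iff' σ.bijective f).mp h

theorem mem_collapseClosure_of_not_injective {α : Type*} [DecidableEq α] [Finite α]
    (f : Function.End α) (hf : ¬ Function.Injective f) :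
    f ∈ collapseClosure α := by
  induction h : (Set.range f)ᶜ.ncard using Nat.strong_induction_on generalizing f with
  | _ k ih =>
    subst h
    obtain ⟨a, b, hfab, hab⟩ : ∃ a b, f a = f b ∧ a ≠ b := by
      simpa [Function.Injective] using hf
    obtain ⟨c, hc⟩ : ∃ c, ∀ x, f x ≠ c := by
      simpa [Function.Surjective] using fun h => hf (Finite.injective_iff_surjective.mpr h)
    let g : Function.End α := Function.update f a c
    have hg : ∀ x, g x = if x = a then c else f x := fun x => Function.update_apply f a c x
    have hfg : f = g * collapse a b := by
      funext x
      change f x = g (collapse a b x)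
      rw [hg, collapse_apply]
      grind
    have hmem := collapse_mem_collapseClosure hab
    rw [hfg]
    by_cases hinj : Function.Injective g
    · have hns : ¬ Function.Surjective (collapse a b) := fun h =>
        (range_collapse hab ▸ h.range_eq ▸ Set.mem_univ a : a ∈ ({a}ᶜ : Set α)) rfl
      exact perm_comp_mem_collapseClosure hmem hns
        (Equiv.ofBijective g (Finite.injective_iff_bijective.mp hinj))
    · refine mul_mem (ih _ ?_ g hinj rfl) hmem
      refine Set.ncard_lt_ncard (compl_lt_compl_iff_lt.mpr ?_) (Set.toFinite _)
      refine (Set.ssubset_iff_of_subset ?_).mpr ⟨c, ⟨a, by simp [hg]⟩, fun ⟨x, hx⟩ => hc x hx⟩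
      rw [hfg]
      exact Set.range_comp_subset_range _ _

theorem eq_one_or_not_bijective_of_mem_closure_idempotents {α : Type*} [Finite α]
    {f : Function.End α} (hf : f ∈ Submonoid.closure {f : Function.End α | f * f = f}) :
    f = 1 ∨ ¬ Function.Bijective f := by
  induction hf using Submonoid.closure_induction with
  | mem f hf =>
    refine or_iff_not_imp_right.mpr fun h => ?_
    funext x
    exact (not_not.mp h).injective (congrFun hf x)
  | one => exact Or.inl rfl
  | mul f g _ _ hf hg =>
    rcases hg with rfl | hg
    · simpa using hf
    · refine Or.inr fun h => hg (Finite.injective_iff_bijective.mp ?_)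
      exact Function.Injective.of_comp (f := f) h.injective

/-- For every `n ≥ 0`, the submonoid of the full transformation monoid `T_n`
(realised as `Function.End (Fin n)`) generated by its idempotents equals
`{1} ∪ (T_n \ S_n)`, i.e. it consists of the identity together with all non-bijective
transformations; moreover this submonoid is already generated by the idempotents of
rank `n - 1`. -/
theorem stmt_1 (n : ℕ) :
    ((Submonoid.closure {f : Function.End (Fin n) | f * f = f} :
        Set (Function.End (Fin n)))
      = {f : Function.End (Fin n) | f = 1 ∨ ¬ Function.Bijective f}) ∧
    Submonoid.closure {f : Function.End (Fin n) | f * f = f}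
      = Submonoid.closure {f : Function.End (Fin n) |
          f * f = f ∧ (Set.range f).ncard = n - 1} := by
  have hsub : ∀ f : Function.End (Fin n), f = 1 ∨ ¬ Function.Bijective f →
      f ∈ Submonoid.closure {f : Function.End (Fin n) |
        f * f = f ∧ (Set.range f).ncard = n - 1} := by
    rintro f (rfl | hf)
    · exact one_mem _
    · refine Submonoid.closure_mono ?_ (mem_collapseClosure_of_not_injective f
        fun h => hf (Finite.injective_iff_bijective.mp h))
      rintro _ ⟨a, b, hab, rfl⟩
      refine ⟨collapse_mul_self hab, ?_⟩
      rw [range_collapse hab, Set.ncard_compl]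
      simp
  have hmono : Submonoid.closure {f : Function.End (Fin n) |
      f * f = f ∧ (Set.range f).ncard = n - 1} ≤
      Submonoid.closure {f : Function.End (Fin n) | f * f = f} :=
    Submonoid.closure_mono fun _ h => h.1
  refine ⟨Set.Subset.antisymm ?_ fun f hf => hmono (hsub f hf), le_antisymm ?_ hmono⟩
  · exact fun f hf => eq_one_or_not_bijective_of_mem_closure_idempotents hf
  · exact fun f hf => hsub f (eq_one_or_not_bijective_of_mem_closure_idempotents hf)
end

section
/- Let n ≥ 0 and let U be a subset of E(D_n), the set of idempotents of rank n−1 in T_n. Define a digraph Γ_U on vertex set {1,...,n} with a directed edge i → j for each e_{ij} ∈ U. Then the submonoid of T_n generated by U equals E_n = {1} ∪ (T_n \ S_n) if and only if Γ_U is strongly connected and complete. -/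
/-- The idempotent `e_{i j}` of the full transformation monoid on `Fin n`, mapping `j` to `i`
and fixing all other points. -/
def eij {n : ℕ} (i j : Fin n) : Function.End (Fin n) :=
  fun x => if x = j then i else x

namespace FullTransformation

variable {n : ℕ}

theorem mul_apply (f g : Function.End (Fin n)) (x : Fin n) : (f * g) x = f (g x) := rfl

/-- An element of the monoid generated by some `e_{i j}` moves each point backwards along a path
of the associated digraph. -/
theorem reflTransGen_of_mem_closure {U : Set (Function.End (Fin n))}
    (hU : U ⊆ {f : Function.End (Fin n) | ∃ i j : Fin n, i ≠ j ∧ f = eij i j})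
    {f : Function.End (Fin n)} (hf : f ∈ Submonoid.closure U) (x : Fin n) :
    Relation.ReflTransGen (fun a b => eij a b ∈ U) (f x) x := by
  induction hf using Submonoid.closure_induction generalizing x with
  | mem f hf =>
    obtain ⟨i, j, -, rfl⟩ := hU hf
    by_cases hx : x = j
    · subst hx
      rw [show eij i x x = i from if_pos rfl]
      exact .single hf
    · rw [show eij i j x = x from if_neg hx]
  | one => exact .refl
  | mul f g _ _ hf hg => exact (hf (g x)).trans (hg x)

/-- A nontrivial element of the monoid generated by some `e_{i j}` identifies the endpoints of an
edge of the associated digraph. -/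
theorem eq_one_or_exists_of_mem_closure {U : Set (Function.End (Fin n))}
    (hU : U ⊆ {f : Function.End (Fin n) | ∃ i j : Fin n, i ≠ j ∧ f = eij i j})
    {f : Function.End (Fin n)} (hf : f ∈ Submonoid.closure U) :
    f = 1 ∨ ∃ i j, i ≠ j ∧ eij i j ∈ U ∧ f i = f j := by
  induction hf using Submonoid.closure_induction with
  | mem f hf =>
    obtain ⟨i, j, hij, rfl⟩ := hU hf
    exact .inr ⟨i, j, hij, hf, by simp [eij]⟩
  | one => exact .inl rfl
  | mul f g _ _ hf hg =>
    obtain rfl | ⟨i, j, hij, hmem, h⟩ := hg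
    · simpa using hf
    · exact .inr ⟨i, j, hij, hmem, by rw [mul_apply, mul_apply, h]⟩

theorem not_bijective_eij {i j : Fin n} (h : i ≠ j) : ¬ Function.Bijective (eij i j) :=
  fun hb => h (hb.1 (by simp [eij]))

/-- The three idempotents on a directed triangle generate the idempotents on the reversed edges. -/
theorem eij_eq_triangle {i j w : Fin n} (hij : i ≠ j) (hiw : i ≠ w) (hwj : w ≠ j) :
    eij i j = (eij w j * eij i w * eij j i) ^ 2 := by
  funext x
  simp only [pow_two, mul_apply, eij]
  grind

theorem eij_mem_of_complete {S : Submonoid (Function.End (Fin n))}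
    (hS : ∀ u v : Fin n, u ≠ v → eij u v ∈ S ∨ eij v u ∈ S) {i j : Fin n}
    (h : Relation.ReflTransGen (fun a b => eij a b ∈ S) i j) (hij : i ≠ j) : eij i j ∈ S := by
  induction h with
  | refl => exact absurd rfl hij
  | @tail w j _ hwj ih =>
    by_cases hiw : i = w
    · exact hiw ▸ hwj
    by_cases hne : w = j
    · exact hne ▸ ih hiw
    rcases hS i j hij with h | h
    · exact h
    · rw [eij_eq_triangle hij hiw hne]
      exact pow_mem (mul_mem (mul_mem hwj (ih hiw)) h) 2

theorem eq_mul_eij {f g : Function.End (Fin n)} {a b : Fin n} (hab : a ≠ b) (h : f a = f b)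
    (hg : ∀ x, x ≠ b → g x = f x) : f = g * eij a b := by
  funext x
  simp only [mul_apply, eij]
  grind

/-- A non-surjective map that is not some `e_{a c}` is the product of a non-surjective map with
more fixed points and of an element of `S`. -/
theorem exists_eq_mul_of_notMem_range {S : Submonoid (Function.End (Fin n))}
    (hS : ∀ i j : Fin n, i ≠ j → eij i j ∈ S) {f : Function.End (Fin n)} {c : Fin n}
    (hc : ∀ x, f x ≠ c) :
    f ∈ S ∨ ∃ g : Function.End (Fin n), ∃ s ∈ S, f = g * s ∧ (∀ x, g x ≠ c) ∧
      ∃ b, f b ≠ b ∧ g b = b ∧ ∀ x, f x = x → g x = x := by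
  have key : ∀ a b, a ≠ b → f a = f b → f b ≠ b → b ≠ c →
      ∃ g : Function.End (Fin n), ∃ s ∈ S, f = g * s ∧ (∀ x, g x ≠ c) ∧
        ∃ b, f b ≠ b ∧ g b = b ∧ ∀ x, f x = x → g x = x := by
    intro a b hab h hb hbc
    refine ⟨fun x => if x = b then b else f x, _, hS a b hab, eq_mul_eij hab h ?_, ?_,
      b, hb, ?_, ?_⟩
    all_goals grind
  have main : ∀ a, a ≠ c → f a = f c → f a = a → f ∈ S ∨
      ∃ g : Function.End (Fin n), ∃ s ∈ S, f = g * s ∧ (∀ x, g x ≠ c) ∧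
        ∃ b, f b ≠ b ∧ g b = b ∧ ∀ x, f x = x → g x = x := by
    intro a hac h ha
    by_cases hfix : ∀ x, x ≠ c → f x = x
    · left
      have : f = eij a c := by
        funext x
        simp only [eij]
        grind
      exact this ▸ hS a c hac
    · push Not at hfix
      obtain ⟨x, hxc, hx⟩ := hfix
      obtain ⟨g, hg⟩ : ∃ g : Function.End (Fin n),
          ∀ y, g y = if y = x then x else if y = c then f x else f y := ⟨fun y => _, fun _ => rfl⟩
      refine .inr ⟨g,
        eij c x * eij a c, mul_mem (hS c x hxc.symm) (hS a c hac), ?_, ?_, x, hx, ?_, ?_⟩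
      · funext y
        simp only [mul_apply, eij]
        grind
      all_goals grind
  have hinj : ¬ Function.Injective f := fun h => by
    obtain ⟨x, hx⟩ := Finite.surjective_of_injective h c
    exact hc x hx
  simp only [Function.Injective, not_forall] at hinj
  obtain ⟨a, b, h, hab⟩ := hinj
  by_cases hb : f b ≠ b ∧ b ≠ c
  · exact .inr (key a b hab h hb.1 hb.2)
  by_cases ha : f a ≠ a ∧ a ≠ c
  · exact .inr (key b a (Ne.symm hab) h.symm ha.1 ha.2)
  by_cases hbc : b = c
  · subst hbc
    exact main a hab h (by grind)
  · exact main b hbc (by grind) (by grind)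

/-- The idempotents `e_{i j}` generate all non-surjective maps. -/
theorem mem_of_notMem_range {S : Submonoid (Function.End (Fin n))}
    (hS : ∀ i j : Fin n, i ≠ j → eij i j ∈ S) {c : Fin n} (f : Function.End (Fin n))
    (hc : ∀ x, f x ≠ c) : f ∈ S := by
  classical
  induction hk : (Finset.univ.filter fun x : Fin n => f x ≠ x).card using Nat.strong_induction_on
    generalizing f with
  | _ k ih =>
    obtain h | ⟨g, s, hs, hfg, hg, b, hfb, hgb, hfix⟩ := exists_eq_mul_of_notMem_range hS hc
    · exact h
    · rw [hfg]
      refine mul_mem (ih _ ?_ g hg rfl) hs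
      rw [← hk]
      refine Finset.card_lt_card (Finset.ssubset_iff_of_subset ?_ |>.2 ⟨b, ?_, ?_⟩)
      · intro x
        simp only [Finset.mem_filter, Finset.mem_univ, true_and]
        exact mt (hfix x)
      · simpa using hfb
      · simpa using hgb

end FullTransformation

open FullTransformation

/-- Let `U ⊆ E(D_n)`, the idempotents of rank `n-1` of `T_n` (i.e. the maps
`e_{ij}` with `i ≠ j`).  The submonoid generated by `U` equals
`E_n = {1} ∪ (T_n \ S_n)` if and only if the digraph `Γ_U` on `{1,…,n}`, with an edge `i → j`
for each `e_{ij} ∈ U`, is strongly connected and complete. -/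
theorem stmt_2 (n : ℕ) (U : Set (Function.End (Fin n)))
    (hU : U ⊆ {f : Function.End (Fin n) | ∃ i j : Fin n, i ≠ j ∧ f = eij i j}) :
    (Submonoid.closure U : Set (Function.End (Fin n)))
        = {f : Function.End (Fin n) | f = 1 ∨ ¬ Function.Bijective f} ↔
      ((∀ u v : Fin n, Relation.ReflTransGen (fun a b => eij a b ∈ U) u v) ∧
       (∀ u v : Fin n, u ≠ v → eij u v ∈ U ∨ eij v u ∈ U)) := by
  constructor
  · intro h
    have hmem : ∀ u v : Fin n, u ≠ v → eij u v ∈ Submonoid.closure U := fun u v huv => by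
      rw [← SetLike.mem_coe, h]
      exact .inr (not_bijective_eij huv)
    refine ⟨fun u v => ?_, fun u v huv => ?_⟩
    · by_cases huv : u = v
      · exact huv ▸ .refl
      · simpa [eij] using reflTransGen_of_mem_closure hU (hmem u v huv) v
    · obtain h1 | ⟨i, j, hij, hU', h'⟩ := eq_one_or_exists_of_mem_closure hU (hmem u v huv)
      · exact absurd (h1 ▸ Function.bijective_id) (not_bijective_eij huv)
      · have : (i = u ∧ j = v) ∨ (i = v ∧ j = u) := by
          simp only [eij] at h'
          grind
        obtain ⟨rfl, rfl⟩ | ⟨rfl, rfl⟩ := this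
        · exact .inl hU'
        · exact .inr hU'
  · rintro ⟨hconn, hcomp⟩
    have hS : ∀ i j : Fin n, i ≠ j → eij i j ∈ Submonoid.closure U := fun i j hij =>
      eij_mem_of_complete
        (fun u v huv => (hcomp u v huv).imp (Submonoid.mem_closure_of_mem ·)
          (Submonoid.mem_closure_of_mem ·))
        (Relation.ReflTransGen.mono (fun _ _ h => Submonoid.mem_closure_of_mem h) _ _ (hconn i j))
        hij
    ext f
    constructor
    · intro hf
      exact (eq_one_or_exists_of_mem_closure hU hf).imp_right
        fun ⟨_, _, hij, _, h⟩ hb => hij (hb.1 h)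
    · rintro (rfl | hf)
      · exact one_mem _
      · have hsurj : ¬ Function.Surjective f := fun h =>
          hf ⟨Finite.injective_iff_surjective.2 h, h⟩
        simp only [Function.Surjective, not_forall, not_exists] at hsurj
        obtain ⟨c, hc⟩ := hsurj
        exact mem_of_notMem_range hS f hc
end

section
/- For every integer n ≥ 0, the rank and the idempotent rank of E_n = {1} ∪ (T_n \ S_n) coincide, and both equal 2 if n = 2 and (n choose 2) otherwise (where (n choose 2) = 0 for n ≤ 1). -/
namespace Function.End

variable {α : Type*}

/-- An injective map in the submonoid generated by the idempotents is the identity. -/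
theorem eq_one_of_injective_of_mem_closure {f : Function.End α}
    (hf : f ∈ Submonoid.closure {f : Function.End α | f * f = f})
    (hinj : Function.Injective f) : f = 1 := by
  induction hf using Submonoid.closure_induction with
  | mem f hf => exact funext fun x => hinj (congrFun hf x)
  | one => rfl
  | mul f g _ _ ihf ihg =>
    obtain rfl := ihg (Function.Injective.of_comp (f := f) hinj)
    rw [mul_one] at hinj ⊢
    exact ihf hinj

/-- A product of generators other than `1` has a kernel containing that of a non-injective
generator. -/
theorem exists_ker_le_of_mem_closure {U : Set (Function.End α)}
    (hU : ∀ u ∈ U, Function.Injective u → u = 1) {f : Function.End α}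
    (hf : f ∈ Submonoid.closure U) :
    f = 1 ∨ ∃ u ∈ U, ¬ Function.Injective u ∧ ∀ x y, u x = u y → f x = f y := by
  induction hf using Submonoid.closure_induction with
  | mem f hf =>
    by_cases h : Function.Injective f
    · exact .inl (hU f hf h)
    · exact .inr ⟨f, hf, h, fun _ _ h => h⟩
  | one => exact .inl rfl
  | mul f g _ _ ihf ihg =>
    rcases ihg with rfl | ⟨u, hu, hni, hker⟩
    · simpa using ihf
    · exact .inr ⟨u, hu, hni, fun x y h => congrArg f (hker x y h)⟩

/-- A product of generators other than `1` has its range in that of a non-injective generator. -/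
theorem exists_range_subset_of_mem_closure {U : Set (Function.End α)}
    (hU : ∀ u ∈ U, Function.Injective u → u = 1) {f : Function.End α}
    (hf : f ∈ Submonoid.closure U) :
    f = 1 ∨ ∃ u ∈ U, ¬ Function.Injective u ∧ ∀ x, ∃ y, u y = f x := by
  induction hf using Submonoid.closure_induction with
  | mem f hf =>
    by_cases h : Function.Injective f
    · exact .inl (hU f hf h)
    · exact .inr ⟨f, hf, h, fun x => ⟨x, rfl⟩⟩
  | one => exact .inl rfl
  | mul f g _ _ ihf ihg =>
    rcases ihf with rfl | ⟨u, hu, hni, hran⟩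
    · simpa using ihg
    · exact .inr ⟨u, hu, hni, fun x => hran (g x)⟩

variable [DecidableEq α]

/-- The idempotent of defect at most one sending `a` to `b` and fixing all other points. -/
def collapse (a b : α) : Function.End α := fun x => if x = a then b else x

theorem collapse_apply (a b x : α) : collapse a b x = if x = a then b else x := rfl

theorem collapse_mul_self (a b : α) : collapse a b * collapse a b = collapse a b := by
  funext x
  change collapse a b (collapse a b x) = collapse a b x
  simp only [collapse_apply]
  grind

theorem collapse_ne_one {a b : α} (h : a ≠ b) : collapse a b ≠ 1 := by
  intro he
  have := congrFun he a
  simp only [collapse_apply, if_true] at this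
  exact h this.symm

/-- The arcs of a directed triangle generate its reversed arcs. -/
theorem collapse_eq_sq_of_triangle {a b c : α} (hab : a ≠ b) (hbc : b ≠ c) (hca : c ≠ a) :
    collapse b a = (collapse b c * collapse c a * collapse a b) ^ 2 := by
  rw [pow_two]
  funext x
  change _ = collapse b c (collapse c a (collapse a b
    (collapse b c (collapse c a (collapse a b x)))))
  simp only [collapse_apply]
  grind

theorem collapse_mem_of_triangle {M : Submonoid (Function.End α)} {a b c : α}
    (hab : a ≠ b) (hbc : b ≠ c) (hca : c ≠ a)
    (h₁ : collapse a b ∈ M) (h₂ : collapse b c ∈ M) (h₃ : collapse c a ∈ M) :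
    collapse b a ∈ M := by
  rw [collapse_eq_sq_of_triangle hab hbc hca]
  exact pow_mem (mul_mem (mul_mem h₂ h₃) h₁) 2

/-- A submonoid containing all the idempotents of defect one contains all idempotents. -/
theorem mem_of_mul_self_eq [Fintype α] {M : Submonoid (Function.End α)}
    (hM : ∀ a b : α, a ≠ b → collapse a b ∈ M) {f : Function.End α} (hf : f * f = f) :
    f ∈ M := by
  classical
  induction hk : (Finset.univ.filter fun x => f x ≠ x).card using Nat.strong_induction_on
    generalizing f with
  | _ k ih =>
    have hff : ∀ x, f (f x) = f x := fun x => congrFun hf x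
    by_cases h : ∃ a, f a ≠ a
    · obtain ⟨a, ha⟩ := h
      let g : Function.End α := fun x => if x = a then a else f x
      have hg : ∀ x, g x = if x = a then a else f x := fun _ => rfl
      have hna : ∀ x, f x ≠ a := fun x hx => ha (by rw [← hx, hff])
      have hgg : g * g = g := by
        funext x
        change g (g x) = g x
        grind
      have hfg : f = collapse a (f a) * g := by
        funext x
        change f x = collapse a (f a) (g x)
        rw [collapse_apply]
        grind
      have hlt : (Finset.univ.filter fun x => g x ≠ x).card < k := by
        rw [← hk]
        apply Finset.card_lt_card
        rw [Finset.ssubset_iff_of_subset]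
        · exact ⟨a, by simp [ha], by simp [hg]⟩
        · intro x
          simp only [Finset.mem_filter, Finset.mem_univ, true_and]
          grind
      rw [hfg]
      exact mul_mem (hM a (f a) ha.symm) (ih _ hlt hgg (by congr))
    · push Not at h
      obtain rfl : f = 1 := funext h
      exact one_mem M

/-- Idempotents generating every idempotent of defect one generate all idempotents. -/
theorem closure_eq_closure_idempotents [Fintype α] {U : Set (Function.End α)}
    (hU : ∀ f ∈ U, f * f = f)
    (h : ∀ a b : α, a ≠ b → collapse a b ∈ Submonoid.closure U) :
    Submonoid.closure U = Submonoid.closure {f : Function.End α | f * f = f} :=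
  le_antisymm (Submonoid.closure_mono hU)
    (Submonoid.closure_le.2 fun _ hf => mem_of_mul_self_eq h hf)

theorem card_filter_lt (n : ℕ) :
    (Finset.univ.filter fun p : Fin n × Fin n => p.1 < p.2).card = n.choose 2 := by
  rw [Finset.card_filter, Fintype.sum_prod_type_right]
  simp_rw [← Finset.card_filter]
  have h : ∀ y : Fin n, (Finset.univ.filter fun x : Fin n => x < y).card = y := fun y => by
    rw [← Fin.card_Iio y]
    congr 1
    ext
    simp
  simp_rw [h]
  rw [Fin.sum_univ_eq_sum_range (fun i => i), Finset.sum_range_id, Nat.choose_two_right]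

theorem choose_two_le_card {n : ℕ} {U : Finset (Function.End (Fin n))}
    (hU : Submonoid.closure (U : Set (Function.End (Fin n)))
      = Submonoid.closure {f : Function.End (Fin n) | f * f = f}) :
    n.choose 2 ≤ U.card := by
  have hone : ∀ u ∈ (U : Set (Function.End (Fin n))), Function.Injective u → u = 1 :=
    fun u hu => eq_one_of_injective_of_mem_closure (hU ▸ Submonoid.subset_closure hu)
  have key : ∀ p : Fin n × Fin n, p.1 < p.2 →
      ∃ u ∈ U, u p.1 = u p.2 ∧ ∀ x y, x < y → u x = u y → p = (x, y) := by
    rintro ⟨i, j⟩ hij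
    have hmem : collapse i j ∈ Submonoid.closure (U : Set (Function.End (Fin n))) :=
      hU ▸ Submonoid.subset_closure (collapse_mul_self i j)
    obtain h | ⟨u, hu, hni, hker⟩ := exists_ker_le_of_mem_closure hone hmem
    · exact absurd h (collapse_ne_one hij.ne)
    · simp only [collapse_apply] at hker
      have hpair : ∀ x y, x < y → u x = u y → (i, j) = (x, y) := by
        intro x y hxy h
        have := hker x y h
        grind
      refine ⟨u, hu, ?_, hpair⟩
      simp only [Function.Injective, not_forall] at hni
      obtain ⟨x, y, hxy, hne⟩ := hni
      rcases lt_or_gt_of_ne hne with hlt | hlt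
      · cases hpair x y hlt hxy
        exact hxy
      · cases hpair y x hlt hxy.symm
        exact hxy.symm
  choose! F hFU hF hFu using key
  rw [← card_filter_lt]
  refine Finset.card_le_card_of_injOn F (fun p hp => hFU p (by simpa using hp)) ?_
  intro p hp q hq hpq
  have hp' : p.1 < p.2 := by simpa using hp
  have hq' : q.1 < q.2 := by simpa using hq
  exact hFu p hp' q.1 q.2 hq' (hpq ▸ hF q hq')

theorem two_le_card {U : Finset (Function.End (Fin 2))}
    (hU : Submonoid.closure (U : Set (Function.End (Fin 2)))
      = Submonoid.closure {f : Function.End (Fin 2) | f * f = f}) :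
    2 ≤ U.card := by
  have hone : ∀ u ∈ (U : Set (Function.End (Fin 2))), Function.Injective u → u = 1 :=
    fun u hu => eq_one_of_injective_of_mem_closure (hU ▸ Submonoid.subset_closure hu)
  have key : ∀ a : Fin 2, ∃ u ∈ U, ∀ x, u x = a := by
    intro a
    obtain ⟨b, hba⟩ : ∃ b : Fin 2, b ≠ a := exists_ne a
    have hmem : collapse b a ∈ Submonoid.closure (U : Set (Function.End (Fin 2))) :=
      hU ▸ Submonoid.subset_closure (collapse_mul_self b a)
    obtain h | ⟨u, hu, hni, hran⟩ := exists_range_subset_of_mem_closure hone hmem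
    · exact absurd h (collapse_ne_one hba)
    · refine ⟨u, hu, fun x => ?_⟩
      obtain ⟨y, hy⟩ := hran b
      simp only [collapse_apply, if_true] at hy
      simp only [Function.Injective, not_forall] at hni
      obtain ⟨s, t, hst, hne⟩ := hni
      rw [← hy]
      obtain rfl | hx : x = s ∨ x = t := by omega
      · obtain rfl | rfl : y = x ∨ y = t := by omega
        · rfl
        · exact hst
      · subst hx
        obtain rfl | rfl : y = s ∨ y = x := by omega
        · exact hst.symm
        · rfl
  choose F hFU hF using key
  refine Finset.one_lt_card.2 ⟨F 0, hFU 0, F 1, hFU 1, fun h => ?_⟩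
  have h0 := hF 0 0
  rw [h, hF 1 0] at h0
  exact one_ne_zero h0

open Classical in
/-- The idempotents of defect one along the arcs of the transitive tournament on `Fin (m + 3)`
with the arc between the endpoints reversed. -/
noncomputable def tournamentGenerators (m : ℕ) : Finset (Function.End (Fin (m + 3))) :=
  (Finset.univ.filter fun p : Fin (m + 3) × Fin (m + 3) => p.1 < p.2).image fun p =>
    if p = (0, Fin.last _) then collapse (Fin.last _) 0 else collapse p.1 p.2

theorem mul_self_of_mem_tournamentGenerators {m : ℕ} {f : Function.End (Fin (m + 3))}
    (hf : f ∈ tournamentGenerators m) : f * f = f := by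
  classical
  obtain ⟨p, -, rfl⟩ := Finset.mem_image.1 hf
  split_ifs <;> exact collapse_mul_self _ _

theorem collapse_mem_closure_tournamentGenerators {m : ℕ} {a b : Fin (m + 3)} (hab : a ≠ b) :
    collapse a b ∈ Submonoid.closure
      (tournamentGenerators m : Set (Function.End (Fin (m + 3)))) := by
  classical
  set M := Submonoid.closure (tournamentGenerators m : Set (Function.End (Fin (m + 3))))
  have hlt : ∀ i j : Fin (m + 3), i < j → (i ≠ 0 ∨ j ≠ Fin.last _) → collapse i j ∈ M := by
    intro i j hij h
    refine Submonoid.subset_closure (Finset.mem_coe.2 (Finset.mem_image.2 ⟨(i, j), by simpa, ?_⟩))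
    rw [if_neg]
    grind
  have hback : collapse (Fin.last _) 0 ∈ M :=
    Submonoid.subset_closure (Finset.mem_coe.2 (Finset.mem_image.2
      ⟨(0, Fin.last _), by simp [Fin.last_pos], by simp⟩))
  have hpos : ∀ i : Fin (m + 3), i ≠ 0 → 0 < i := fun i h => Fin.pos_of_ne_zero h
  have hlast : ∀ i : Fin (m + 3), i ≠ Fin.last _ → i < Fin.last _ :=
    fun i h => Fin.lt_last_iff_ne_last.2 h
  have h0l : (0 : Fin (m + 3)) ≠ Fin.last _ := by simp [Fin.ext_iff]
  have hfirst : ∀ i : Fin (m + 3), i ≠ 0 → i ≠ Fin.last _ → collapse i 0 ∈ M := fun i h0 hl =>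
    collapse_mem_of_triangle h0.symm hl h0l.symm (hlt 0 i (hpos i h0) (.inr hl))
      (hlt i _ (hlast i hl) (.inl h0)) hback
  have hend : ∀ i : Fin (m + 3), i ≠ 0 → i ≠ Fin.last _ → collapse (Fin.last _) i ∈ M :=
    fun i h0 hl =>
      collapse_mem_of_triangle hl h0l.symm h0.symm (hlt i _ (hlast i hl) (.inl h0)) hback
        (hlt 0 i (hpos i h0) (.inr hl))
  have hforth : collapse 0 (Fin.last _) ∈ M := by
    have h0 : (1 : Fin (m + 3)) ≠ 0 := by simp
    have hl : (1 : Fin (m + 3)) ≠ Fin.last _ := by simp [Fin.ext_iff]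
    exact collapse_mem_of_triangle h0l.symm h0.symm hl hback (hlt 0 1 (hpos 1 h0) (.inr hl))
      (hlt 1 _ (hlast 1 hl) (.inl h0))
  rcases lt_or_gt_of_ne hab with h | h
  · by_cases hc : a ≠ 0 ∨ b ≠ Fin.last _
    · exact hlt a b h hc
    · push Not at hc
      rw [hc.1, hc.2]
      exact hforth
  · have ha : a ≠ 0 := ((Fin.zero_le b).trans_lt h).ne'
    have hb : b ≠ Fin.last _ := (h.trans_le (Fin.le_last a)).ne
    by_cases hb0 : b = 0
    · subst hb0
      by_cases hal : a = Fin.last _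
      · exact hal ▸ hback
      · exact hfirst a ha hal
    · by_cases hal : a = Fin.last _
      · exact hal ▸ hend b hb0 hb
      · exact collapse_mem_of_triangle h.ne ha (Ne.symm hb0) (hlt b a h (.inl hb0))
          (hfirst a ha hal) (hlt 0 b (hpos b hb0) (.inr hb))

theorem exists_idempotent_generators (n : ℕ) :
    ∃ U : Finset (Function.End (Fin n)), (∀ f ∈ U, f * f = f) ∧
      Submonoid.closure (U : Set (Function.End (Fin n)))
        = Submonoid.closure {f : Function.End (Fin n) | f * f = f} ∧
      U.card ≤ if n = 2 then 2 else n.choose 2 := by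
  classical
  match n with
  | 0 => exact ⟨∅, by simp, closure_eq_closure_idempotents (by simp) fun a => a.elim0, by simp⟩
  | 1 =>
    exact ⟨∅, by simp,
      closure_eq_closure_idempotents (by simp) fun a b h => absurd (Subsingleton.elim a b) h,
      by simp⟩
  | 2 =>
    have hid : ∀ f ∈ ({collapse 0 1, collapse 1 0} : Finset (Function.End (Fin 2))),
        f * f = f := by
      simp [collapse_mul_self]
    refine ⟨_, hid, closure_eq_closure_idempotents hid fun a b h => ?_, Finset.card_le_two⟩
    apply Submonoid.subset_closure
    fin_cases a <;> fin_cases b <;> simp_all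
  | m + 3 =>
    refine ⟨tournamentGenerators m, fun f => mul_self_of_mem_tournamentGenerators,
      closure_eq_closure_idempotents (fun f => mul_self_of_mem_tournamentGenerators)
        fun a b => collapse_mem_closure_tournamentGenerators, ?_⟩
    rw [if_neg (by omega), ← card_filter_lt]
    exact Finset.card_image_le

theorem le_card_of_closure_eq {n : ℕ} {U : Finset (Function.End (Fin n))}
    (hU : Submonoid.closure (U : Set (Function.End (Fin n)))
      = Submonoid.closure {f : Function.End (Fin n) | f * f = f}) :
    (if n = 2 then 2 else n.choose 2) ≤ U.card := by
  split_ifs with h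
  · subst h
    exact two_le_card hU
  · exact choose_two_le_card hU

end Function.End


/-- For every `n ≥ 0`, the rank and the idempotent rank of
`E_n = {1} ∪ (T_n \ S_n)`, the submonoid of `T_n` generated by the idempotents, coincide:
both equal `2` if `n = 2` and `(n choose 2)` otherwise.  Here the rank is the least
cardinality of a generating set, and the idempotent rank is the least cardinality of a
generating set consisting of idempotents. -/
theorem stmt_3 (n : ℕ) :
    IsLeast {k : ℕ | ∃ U : Finset (Function.End (Fin n)),
        Submonoid.closure (U : Set (Function.End (Fin n)))
          = Submonoid.closure {f : Function.End (Fin n) | f * f = f} ∧ U.card = k}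
      (if n = 2 then 2 else n.choose 2) ∧
    IsLeast {k : ℕ | ∃ U : Finset (Function.End (Fin n)),
        (∀ f ∈ U, f * f = f) ∧
        Submonoid.closure (U : Set (Function.End (Fin n)))
          = Submonoid.closure {f : Function.End (Fin n) | f * f = f} ∧ U.card = k}
      (if n = 2 then 2 else n.choose 2) := by
  obtain ⟨U, hid, hU, hcard⟩ := Function.End.exists_idempotent_generators n
  have hcard := hcard.antisymm (Function.End.le_card_of_closure_eq hU)
  refine ⟨⟨⟨U, hU, hcard⟩, ?_⟩, ⟨⟨U, hid, hU, hcard⟩, ?_⟩⟩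
  · rintro _ ⟨V, hV, rfl⟩
    exact Function.End.le_card_of_closure_eq hV
  · rintro _ ⟨V, -, hV, rfl⟩
    exact Function.End.le_card_of_closure_eq hV
end

section
/- For every integer n ≥ 0 with n ≠ 2, the map sending a subset U ⊆ E(D_n) to the digraph Γ_U (vertex set {1,...,n}, with edge i → j whenever e_{ij} ∈ U) gives a one-to-one correspondence between the idempotent generating sets of E_n of minimal cardinality (n choose 2) and the strongly connected tournaments on n labelled vertices; in particular, the number of minimal idempotent generating sets of E_n equals the number of strongly connected tournaments on n vertices. -/
/-- The kernel of `g` identifies at most the two points `i` and `j`. -/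
def KerWithin {n : ℕ} (i j : Fin n) (g : Function.End (Fin n)) : Prop :=
  ∀ x y, g x = g y → x = y ∨ (x = i ∧ y = j) ∨ (x = j ∧ y = i)

namespace KerWithin

variable {n : ℕ} {i j : Fin n} {f g : Function.End (Fin n)}

theorem of_mul (h : KerWithin i j (f * g)) : KerWithin i j g :=
  fun x y hxy => h x y (congrArg f hxy)

theorem of_eij (i j : Fin n) : KerWithin i j (eij i j) := by
  intro x y h
  unfold eij at h
  grind

theorem symm (h : KerWithin i j g) : KerWithin j i g :=
  fun x y hxy => (h x y hxy).imp_right Or.symm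

theorem eq_of_idempotent (hg : g * g = g) (h : KerWithin i j g) :
    g = 1 ∨ g = eij i j ∨ g = eij j i := by
  have hi : ∀ x, g (g x) = g x := congrFun hg
  have hx : ∀ x, g x = x ∨ (g x = i ∧ x = j) ∨ (g x = j ∧ x = i) := fun x => h _ _ (hi x)
  by_cases h1 : g i = i
  · by_cases h2 : g j = j
    · left
      funext x
      change g x = x
      grind
    · right; left
      funext x
      unfold eij
      grind
  · right; right
    funext x
    unfold eij
    grind

/-- If the kernel of `g` lies within `{i, j}` and `g` misses `c`, then `g` identifies `i` and `j`
and misses nothing else. -/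
theorem range_of_notMem (h : KerWithin i j g) {c : Fin n} (hc : c ∉ Set.range g) :
    g i = g j ∧ ∀ y, y ≠ c → y ∈ Set.range g := by
  constructor
  · have hns : ¬ Function.Surjective g := fun hs => hc (hs c)
    obtain ⟨x, y, hxy, hne⟩ :=
      Function.not_injective_iff.1 (mt (Finite.injective_iff_surjective (f := g)).1 hns)
    rcases h x y hxy with h' | ⟨rfl, rfl⟩ | ⟨rfl, rfl⟩
    exacts [absurd h' hne, hxy, hxy.symm]
  · have hsub : (Finset.univ.erase j).image g ⊆ Finset.univ.erase c := by
      intro y hy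
      obtain ⟨x, -, rfl⟩ := Finset.mem_image.1 hy
      exact Finset.mem_erase.2 ⟨fun hx => hc ⟨x, hx⟩, Finset.mem_univ _⟩
    have hinj : Set.InjOn g (Finset.univ.erase j : Finset (Fin n)) := by
      intro x hx y hy hxy
      have := h x y hxy
      simp only [Finset.coe_erase, Finset.coe_univ, Set.mem_sdiff, Set.mem_univ, true_and,
        Set.mem_singleton_iff] at hx hy
      grind
    have heq := Finset.eq_of_subset_of_card_le hsub (by
      rw [Finset.card_image_of_injOn hinj]
      simp)
    intro y hy
    have : y ∈ (Finset.univ.erase j).image g := by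
      rw [heq]
      simp [hy]
    obtain ⟨x, -, hx⟩ := Finset.mem_image.1 this
    exact ⟨x, hx⟩

end KerWithin

section Eij

variable {n : ℕ}

theorem eij_apply_right (i j : Fin n) : eij i j j = i := if_pos rfl

theorem eij_apply_of_ne (i : Fin n) {j x : Fin n} (h : x ≠ j) : eij i j x = x := if_neg h

theorem eij_self (i : Fin n) : eij i i = 1 := by
  funext x
  change eij i i x = x
  unfold eij
  grind

theorem eij_mul_self (i j : Fin n) : eij i j * eij i j = eij i j := by
  funext x
  change eij i j (eij i j x) = eij i j x
  unfold eij
  grind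

theorem eij_ne_one {i j : Fin n} (h : i ≠ j) : eij i j ≠ 1 := by
  intro h1
  have : eij i j j = j := congrFun h1 j
  exact h ((eij_apply_right i j).symm.trans this)

theorem eij_injective {i j k l : Fin n} (h : i ≠ j) (he : eij i j = eij k l) :
    i = k ∧ j = l := by
  have h1 := congrFun he j
  rw [eij_apply_right] at h1
  unfold eij at h1
  grind

theorem notMem_range_eij {i j : Fin n} (h : i ≠ j) : j ∉ Set.range (eij i j) := by
  rintro ⟨x, hx⟩
  unfold eij at hx
  grind

theorem eq_of_notMem_range_eij {i j c : Fin n} (h : c ∉ Set.range (eij i j)) : c = j := by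
  by_contra hc
  exact h ⟨c, eij_apply_of_ne i hc⟩

/-- Reversing an edge of a directed triangle. -/
theorem eij_reverse_of_triangle {i j c : Fin n} (hij : i ≠ j) (hjc : j ≠ c) (hci : c ≠ i) :
    eij c i * (eij j c * (eij i j * (eij c i * (eij j c * eij i j)))) = eij j i := by
  funext x
  change eij c i (eij j c (eij i j (eij c i (eij j c (eij i j x))))) = eij j i x
  unfold eij
  by_cases h1 : x = i
  · subst h1; simp [*, hij.symm, hjc.symm, hci.symm]
  by_cases h2 : x = j
  · subst h2; simp [*, hij.symm, hjc.symm, hci.symm]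
  by_cases h3 : x = c
  · subst h3; simp [*, hij.symm, hjc.symm, hci.symm]
  simp [*]

/-- Every idempotent is a product of the idempotents `eij i j`. -/
theorem idempotent_mem_of_eij_mem {M : Submonoid (Function.End (Fin n))}
    (hM : ∀ i j, i ≠ j → eij i j ∈ M) {f : Function.End (Fin n)} (hf : f * f = f) : f ∈ M := by
  classical
  induction hk : (Finset.univ.filter fun x => f x ≠ x).card using Nat.strong_induction_on
    generalizing f with
  | _ k ih =>
    have hff : ∀ x, f (f x) = f x := congrFun hf
    by_cases hid : ∀ x, f x = x
    · have : f = 1 := funext hid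
      exact this ▸ M.one_mem
    · push Not at hid
      obtain ⟨x, hx⟩ := hid
      obtain ⟨f', hdef⟩ : ∃ f' : Function.End (Fin n), ∀ y, f' y = if y = x then x else f y :=
        ⟨fun y => if y = x then x else f y, fun _ => rfl⟩
      have hf' : f' * f' = f' := by
        funext y
        change f' (f' y) = f' y
        grind
      have hmul : eij (f x) x * f' = f := by
        funext y
        change eij (f x) x (f' y) = f y
        unfold eij
        grind
      have hlt : (Finset.univ.filter fun y => f' y ≠ y).card < k := by
        rw [← hk]
        apply Finset.card_lt_card
        refine Finset.ssubset_iff_of_subset ?_ |>.2 ⟨x, by simpa using hx, by simp [hdef]⟩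
        intro y
        simp only [Finset.mem_filter, Finset.mem_univ, true_and]
        grind
      rw [← hmul]
      exact M.mul_mem (hM _ _ hx) (ih _ hlt hf' rfl)

/-- A submonoid containing `eij i j` for every edge `i → j` of a strongly connected tournament
contains `eij i j` for all `i ≠ j`. -/
theorem eij_mem_of_tournament {R : Fin n → Fin n → Prop}
    (htot : ∀ u v, u ≠ v → (R u v ↔ ¬ R v u)) {M : Submonoid (Function.End (Fin n))}
    (hM : ∀ i j, R i j → eij i j ∈ M) {j i : Fin n} (hp : Relation.ReflTransGen R j i) :
    eij j i ∈ M := by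
  induction hp using Relation.ReflTransGen.head_induction_on with
  | refl => exact eij_self i ▸ M.one_mem
  | @head j c hjc hci ih =>
    by_cases hji : R j i
    · exact hM _ _ hji
    by_cases hne : j = i
    · subst hne
      exact eij_self j ▸ M.one_mem
    have hij : R i j := (htot i j (Ne.symm hne)).2 hji
    have hci : c ≠ i := fun h => hji (h ▸ hjc)
    by_cases hjc' : j = c
    · exact hjc' ▸ ih
    rw [← eij_reverse_of_triangle (Ne.symm hne) hjc' hci]
    have h1 := hM _ _ hij
    have h2 := hM _ _ hjc
    exact M.mul_mem ih (M.mul_mem h2 (M.mul_mem h1 (M.mul_mem ih (M.mul_mem h2 h1))))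

/-- A set of idempotents generating `eij i j` contains `eij i j` or `eij j i`. -/
theorem eij_mem_or_mem_of_mem_closure {U : Set (Function.End (Fin n))}
    (hU : ∀ f ∈ U, f * f = f) {i j : Fin n} (hij : i ≠ j)
    (h : eij i j ∈ Submonoid.closure U) : eij i j ∈ U ∨ eij j i ∈ U := by
  have key : ∀ g ∈ Submonoid.closure U, KerWithin i j g →
      g = 1 ∨ eij i j ∈ U ∨ eij j i ∈ U := by
    intro g hg
    induction hg using Submonoid.closure_induction_left with
    | one => exact fun _ => Or.inl rfl
    | mul_left u hu g _ ih =>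
      intro hk
      rcases ih hk.of_mul with rfl | h'
      · rw [mul_one] at hk ⊢
        rcases hk.eq_of_idempotent (hU u hu) with h' | rfl | rfl
        exacts [Or.inl h', Or.inr (Or.inl hu), Or.inr (Or.inr hu)]
      · exact Or.inr h'
  exact (key _ h (KerWithin.of_eij i j)).resolve_left (eij_ne_one hij)

/-- If `i → j` is an edge of an oriented graph `R` and the idempotents attached to the edges
generate `eij j i`, then `R` has a directed path from `j` to `i`. -/
theorem reflTransGen_of_eij_mem_closure {U : Set (Function.End (Fin n))}
    {R : Fin n → Fin n → Prop} (hirr : ∀ u, ¬ R u u) (hasymm : ∀ u v, R u v → ¬ R v u)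
    (hU : ∀ f ∈ U, ∃ a b, R a b ∧ f = eij a b) {i j : Fin n} (hij : R i j)
    (h : eij j i ∈ Submonoid.closure U) : Relation.ReflTransGen R j i := by
  have key : ∀ g ∈ Submonoid.closure U, KerWithin i j g →
      g = 1 ∨ ∃ c, c ∉ Set.range g ∧ Relation.ReflTransGen R j c := by
    intro g hg
    induction hg using Submonoid.closure_induction_left with
    | one => exact fun _ => Or.inl rfl
    | mul_left u hu g _ ih =>
      intro hk
      right
      obtain ⟨a, b, hab, rfl⟩ := hU u hu
      have hne : a ≠ b := fun h' => hirr b (h' ▸ hab)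
      have hb : b ∉ Set.range (eij a b * g) := by
        rintro ⟨x, hx⟩
        exact notMem_range_eij hne ⟨g x, hx⟩
      rcases ih hk.of_mul with rfl | ⟨c, hc, hp⟩
      · rw [mul_one] at hk hb ⊢
        have heq : eij a b a = eij a b b := by
          rw [eij_apply_right, eij_apply_of_ne a hne]
        rcases hk a b heq with h' | ⟨rfl, rfl⟩ | ⟨rfl, rfl⟩
        · exact absurd h' hne
        · exact ⟨b, hb, .refl⟩
        · exact absurd hij (hasymm _ _ hab)
      · by_cases hca : c = a
        · subst hca
          exact ⟨b, hb, hp.tail hab⟩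
        by_cases hcb : c = b
        · subst hcb
          exact ⟨c, hb, hp⟩
        obtain ⟨hgij, hr⟩ := hk.of_mul.range_of_notMem hc
        obtain ⟨x, hx⟩ := hr a (Ne.symm hca)
        obtain ⟨y, hy⟩ := hr b (Ne.symm hcb)
        have heq : (eij a b * g) x = (eij a b * g) y := by
          change eij a b (g x) = eij a b (g y)
          rw [hx, hy, eij_apply_right, eij_apply_of_ne a hne]
        rcases hk x y heq with rfl | ⟨rfl, rfl⟩ | ⟨rfl, rfl⟩
        · exact absurd (hx.symm.trans hy) hne
        · exact absurd (hx.symm.trans (hgij.trans hy)) hne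
        · exact absurd (hx.symm.trans (hgij.symm.trans hy)) hne
  have hne : j ≠ i := fun h' => hirr i (by rwa [h'] at hij)
  obtain ⟨c, hc, hp⟩ := (key _ h (KerWithin.of_eij j i).symm).resolve_left (eij_ne_one hne)
  rwa [← eq_of_notMem_range_eij hc]

/-- A set meeting every `{eij i j, eij j i}` has cardinality `n.choose 2` iff it consists of
exactly one element of each of these pairs. -/
theorem ncard_eq_choose_two_iff {U : Set (Function.End (Fin n))}
    (hU : ∀ i j, i ≠ j → eij i j ∈ U ∨ eij j i ∈ U) :
    U.ncard = n.choose 2 ↔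
      (∀ i j, i ≠ j → eij i j ∈ U → eij j i ∉ U) ∧
        ∀ f ∈ U, ∃ i j, i ≠ j ∧ f = eij i j := by
  have hex : ∀ s : {s : Sym2 (Fin n) // ¬ s.IsDiag}, ∃ f ∈ U, ∃ i j,
      i ≠ j ∧ s.1 = s(i, j) ∧ f = eij i j := by
    rintro ⟨s, hs⟩
    induction s using Sym2.ind with
    | _ i j =>
      have hij : i ≠ j := by simpa using hs
      rcases hU i j hij with h | h
      · exact ⟨_, h, i, j, hij, rfl, rfl⟩
      · exact ⟨_, h, j, i, hij.symm, Sym2.eq_swap, rfl⟩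
  choose g hgU hg using hex
  have hginj : Function.Injective g := by
    intro s t hst
    obtain ⟨i, j, hij, hs, hi⟩ := hg s
    obtain ⟨k, l, -, ht, hk⟩ := hg t
    obtain ⟨rfl, rfl⟩ := eij_injective hij (hi.symm.trans (hst.trans hk))
    exact Subtype.ext (hs.trans ht.symm)
  have hcard : (Set.range g).ncard = n.choose 2 := by
    rw [← Set.image_univ, Set.ncard_image_of_injective _ hginj, Set.ncard_univ,
      Nat.card_eq_fintype_card, Sym2.card_subtype_not_diag, Fintype.card_fin]
  have hsub : Set.range g ⊆ U := Set.range_subset_iff.2 hgU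
  have : Finite (Function.End (Fin n)) := inferInstanceAs (Finite (Fin n → Fin n))
  have hiff : U.ncard = n.choose 2 ↔ U ⊆ Set.range g := by
    rw [← hcard]
    exact ⟨fun h => (Set.eq_of_subset_of_ncard_le hsub h.le).ge,
      fun h => congrArg _ (h.antisymm hsub)⟩
  rw [hiff]
  constructor
  · intro h
    refine ⟨fun i j hij h1 h2 => ?_, fun f hf => ?_⟩
    · obtain ⟨s, hs⟩ := h h1
      obtain ⟨t, ht⟩ := h h2
      obtain ⟨a, b, hab, hsab, hfa⟩ := hg s
      obtain ⟨c, d, hcd, htcd, hfc⟩ := hg t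
      obtain ⟨rfl, rfl⟩ := eij_injective hij (hs.symm.trans hfa)
      obtain ⟨rfl, rfl⟩ := eij_injective hij.symm (ht.symm.trans hfc)
      have hst : s = t := Subtype.ext (hsab.trans (Sym2.eq_swap.trans htcd.symm))
      subst hst
      exact hij (eij_injective hij (hs.symm.trans ht)).1
    · obtain ⟨s, rfl⟩ := h hf
      obtain ⟨i, j, hij, -, h'⟩ := hg s
      exact ⟨i, j, hij, h'⟩
  · rintro ⟨h1, h2⟩ f hf
    obtain ⟨i, j, hij, rfl⟩ := h2 f hf
    refine ⟨⟨s(i, j), by simpa using hij⟩, ?_⟩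
    obtain ⟨a, b, -, hs, hab⟩ := hg ⟨s(i, j), by simpa using hij⟩
    have hm := hgU ⟨s(i, j), by simpa using hij⟩
    rw [hab] at hm ⊢
    rcases Sym2.eq_iff.1 hs with ⟨rfl, rfl⟩ | ⟨rfl, rfl⟩
    · rfl
    · exact absurd hm (h1 _ _ hij hf)

end Eij

/-- For `n ≠ 2`, the map `U ↦ Γ_U` (sending a set of idempotents to the
digraph on `{1,…,n}` with an edge `i → j` whenever `e_{ij} ∈ U`) is a one-to-one
correspondence between the idempotent generating sets of `E_n` of minimal cardinality
`(n choose 2)` and the strongly connected tournaments on `n` labelled vertices; in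
particular the two collections have the same number of elements. -/
theorem stmt_4 (n : ℕ) (hn : n ≠ 2) :
    Set.BijOn (fun U : Set (Function.End (Fin n)) => fun i j : Fin n => eij i j ∈ U)
      {U : Set (Function.End (Fin n)) |
        (∀ f ∈ U, f * f = f) ∧
        Submonoid.closure U = Submonoid.closure {f : Function.End (Fin n) | f * f = f} ∧
        U.ncard = n.choose 2}
      {R : Fin n → Fin n → Prop |
        (∀ u : Fin n, ¬ R u u) ∧
        (∀ u v : Fin n, u ≠ v → (R u v ↔ ¬ R v u)) ∧
        (∀ u v : Fin n, Relation.ReflTransGen R u v)} ∧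
    {U : Set (Function.End (Fin n)) |
        (∀ f ∈ U, f * f = f) ∧
        Submonoid.closure U = Submonoid.closure {f : Function.End (Fin n) | f * f = f} ∧
        U.ncard = n.choose 2}.ncard
      = {R : Fin n → Fin n → Prop |
          (∀ u : Fin n, ¬ R u u) ∧
          (∀ u v : Fin n, u ≠ v → (R u v ↔ ¬ R v u)) ∧
          (∀ u v : Fin n, Relation.ReflTransGen R u v)}.ncard := by
  have hpair : ∀ U : Set (Function.End (Fin n)), (∀ f ∈ U, f * f = f) →
      Submonoid.closure U = Submonoid.closure {f : Function.End (Fin n) | f * f = f} →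
      ∀ i j, i ≠ j → eij i j ∈ U ∨ eij j i ∈ U := fun U hU hgen i j hij =>
    eij_mem_or_mem_of_mem_closure hU hij
      (hgen ▸ Submonoid.subset_closure (eij_mul_self i j))
  refine (and_iff_left_of_imp fun hb => ?_).2 ⟨?_, ?_, ?_⟩
  · rw [← hb.image_eq, hb.injOn.ncard_image]
  · rintro U ⟨hU, hgen, hcard⟩
    have hp := hpair U hU hgen
    obtain ⟨h1, h2⟩ := (ncard_eq_choose_two_iff hp).1 hcard
    have hirr : ∀ u : Fin n, eij u u ∉ U := by
      intro u hu
      obtain ⟨i, j, hij, he⟩ := h2 _ hu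
      exact eij_ne_one hij (he.symm.trans (eij_self u))
    have hasymm : ∀ u v : Fin n, eij u v ∈ U → eij v u ∉ U := fun u v h =>
      h1 u v (fun huv => hirr v (huv ▸ h)) h
    refine ⟨hirr, fun u v huv => ⟨hasymm u v, (hp u v huv).resolve_right⟩, fun u v => ?_⟩
    by_cases huv : u = v
    · exact huv ▸ .refl
    rcases hp u v huv with h | h
    · exact .single h
    · refine reflTransGen_of_eij_mem_closure (U := U) hirr hasymm ?_ h
        (hgen ▸ Submonoid.subset_closure (eij_mul_self u v))
      intro f hf
      obtain ⟨i, j, -, rfl⟩ := h2 f hf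
      exact ⟨i, j, hf, rfl⟩
  · have hle : ∀ U V : Set (Function.End (Fin n)), (∀ f ∈ U, ∃ i j, i ≠ j ∧ f = eij i j) →
        ((fun i j : Fin n => eij i j ∈ U) = fun i j => eij i j ∈ V) → U ⊆ V := by
      intro U V hU h f hf
      obtain ⟨i, j, -, rfl⟩ := hU f hf
      exact (congrFun (congrFun h i) j).mp hf
    rintro U ⟨hU, hUgen, hUcard⟩ V ⟨hV, hVgen, hVcard⟩ h
    exact (hle U V ((ncard_eq_choose_two_iff (hpair U hU hUgen)).1 hUcard).2 h).antisymm
      (hle V U ((ncard_eq_choose_two_iff (hpair V hV hVgen)).1 hVcard).2 h.symm)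
  · rintro R ⟨hirr, htot, hconn⟩
    have hne : ∀ {i j}, R i j → i ≠ j := fun h h' => hirr _ (h' ▸ h)
    let U : Set (Function.End (Fin n)) := {f | ∃ i j, R i j ∧ f = eij i j}
    have hmem : ∀ i j, eij i j ∈ U ↔ R i j := by
      refine fun i j => ⟨?_, fun h => ⟨i, j, h, rfl⟩⟩
      rintro ⟨a, b, hab, he⟩
      obtain ⟨rfl, rfl⟩ := eij_injective (hne hab) he.symm
      exact hab
    have hidem : ∀ f ∈ U, f * f = f := by
      rintro _ ⟨i, j, -, rfl⟩
      exact eij_mul_self i j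
    refine ⟨U, ⟨hidem, ?_, ?_⟩, ?_⟩
    · refine le_antisymm (Submonoid.closure_mono hidem) (Submonoid.closure_le.2 fun f hf => ?_)
      exact idempotent_mem_of_eij_mem (fun i j _ => eij_mem_of_tournament htot
        (fun a b hab => Submonoid.subset_closure ((hmem a b).2 hab)) (hconn i j)) hf
    · refine (ncard_eq_choose_two_iff fun i j hij => ?_).2 ⟨fun i j hij h => ?_, ?_⟩
      · rw [hmem, hmem, htot i j hij]
        exact (em _).symm
      · rw [hmem] at h ⊢
        exact (htot i j hij).1 h
      · rintro f ⟨i, j, h, rfl⟩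
        exact ⟨i, j, hne h, rfl⟩
    · funext i j
      exact propext (hmem i j)
end

section
/- Let w_n denote the number of strongly connected tournaments on n ≥ 0 labelled vertices. Then w_0 = 1 and, for n ≥ 1, w_n = 2^(n(n−1)/2) − ∑_{s=1}^{n−1} (n choose s) · w_s · 2^((n−s)(n−s−1)/2). -/
/-- A tournament on `Fin k`: a digraph in which, for each pair of distinct vertices,
exactly one of the two possible directed edges is present (and there are no loops). -/
def IsTournament {k : ℕ} (R : Fin k → Fin k → Prop) : Prop :=
  (∀ u, ¬ R u u) ∧ ∀ u v, u ≠ v → (R u v ↔ ¬ R v u)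

/-- A digraph on `Fin k` is strongly connected if any vertex can be reached from any
other by a directed path. -/
def StronglyConnected {k : ℕ} (R : Fin k → Fin k → Prop) : Prop :=
  ∀ u v, Relation.ReflTransGen R u v

/-- The number of strongly connected tournaments on `k` labelled vertices. -/
noncomputable def w (k : ℕ) : ℕ :=
  Nat.card {R : Fin k → Fin k → Prop // IsTournament R ∧ StronglyConnected R}

/-- The tournaments with vertex set `α`. -/
def TournamentOn (α : Type*) : Type _ :=
  {R : α → α → Prop // (∀ u, ¬ R u u) ∧ ∀ u v, u ≠ v → (R u v ↔ ¬ R v u)}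

/-- The strongly connected tournaments with vertex set `α`. -/
def StrongTournamentOn (α : Type*) : Type _ :=
  {R : α → α → Prop // ((∀ u, ¬ R u u) ∧ ∀ u v, u ≠ v → (R u v ↔ ¬ R v u)) ∧
    ∀ u v, Relation.ReflTransGen R u v}

instance (α : Type*) [Finite α] : Finite (TournamentOn α) := Subtype.finite

theorem reflTransGen_comap_equiv {α β : Type*} (e : α ≃ β) {R : β → β → Prop} {u v : β}
    (h : Relation.ReflTransGen R u v) :
    Relation.ReflTransGen (fun a b => R (e a) (e b)) (e.symm u) (e.symm v) :=
  h.lift e.symm fun a b hab => by simpa [Function.onFun] using hab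

/-- Relabelling the vertices of a tournament. -/
def TournamentOn.congr {α β : Type*} (e : α ≃ β) : TournamentOn α ≃ TournamentOn β where
  toFun R := ⟨fun a b => R.1 (e.symm a) (e.symm b), fun u => R.2.1 _,
    fun u v h => R.2.2 _ _ (e.symm.injective.ne h)⟩
  invFun R := ⟨fun a b => R.1 (e a) (e b), fun u => R.2.1 _,
    fun u v h => R.2.2 _ _ (e.injective.ne h)⟩
  left_inv R := Subtype.ext (by simp)
  right_inv R := Subtype.ext (by simp)

/-- Relabelling the vertices of a strongly connected tournament. -/
def StrongTournamentOn.congr {α β : Type*} (e : α ≃ β) :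
    StrongTournamentOn α ≃ StrongTournamentOn β where
  toFun R := ⟨fun a b => R.1 (e.symm a) (e.symm b), ⟨fun u => R.2.1.1 _,
    fun u v h => R.2.1.2 _ _ (e.symm.injective.ne h)⟩, fun u v => by
      simpa using reflTransGen_comap_equiv e.symm (R.2.2 (e.symm u) (e.symm v))⟩
  invFun R := ⟨fun a b => R.1 (e a) (e b), ⟨fun u => R.2.1.1 _,
    fun u v h => R.2.1.2 _ _ (e.injective.ne h)⟩, fun u v => by
      simpa using reflTransGen_comap_equiv e (R.2.2 (e u) (e v))⟩
  left_inv R := Subtype.ext (by simp)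
  right_inv R := Subtype.ext (by simp)

theorem card_strongTournamentOn {α : Type*} [Finite α] :
    Nat.card (StrongTournamentOn α) = w (Nat.card α) :=
  Nat.card_congr (StrongTournamentOn.congr (Finite.equivFin α))

/-- A tournament with a distinguished vertex amounts to a tournament on the other vertices
together with the out-neighbourhood of the distinguished vertex. -/
def TournamentOn.optionEquiv (α : Type*) :
    TournamentOn (Option α) ≃ TournamentOn α × (α → Prop) where
  toFun R := (⟨fun a b => R.1 (some a) (some b), fun u => R.2.1 _,
    fun u v h => R.2.2 _ _ (by simpa using h)⟩, fun a => R.1 none (some a))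
  invFun p := ⟨fun a b => match a, b with
      | none, none => False
      | none, some b => p.2 b
      | some a, none => ¬ p.2 a
      | some a, some b => p.1.1 a b, by
    rintro (_ | u)
    · simp
    · exact p.1.2.1 u, by
    rintro (_ | u) (_ | v) h
    · simp at h
    · simp
    · simp
    · exact p.1.2.2 u v (by simpa using h)⟩
  left_inv R := by
    apply Subtype.ext
    funext a b
    rcases a with _ | a <;> rcases b with _ | b
    · simpa using R.2.1 none
    · rfl
    · simpa using (R.2.2 (some a) none (by simp)).symm
    · rfl
  right_inv p := rfl

theorem card_tournamentOn_fin (n : ℕ) :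
    Nat.card (TournamentOn (Fin n)) = 2 ^ (n * (n - 1) / 2) := by
  induction n with
  | zero =>
    have : Unique (TournamentOn (Fin 0)) :=
      ⟨⟨⟨fun _ _ => False, fun u => u.elim0, fun u => u.elim0⟩⟩,
        fun R => Subtype.ext (funext fun u => u.elim0)⟩
    simp
  | succ n ih =>
    have h : (n + 1) * (n + 1 - 1) / 2 = n * (n - 1) / 2 + n := by
      rw [← Finset.sum_range_id, ← Finset.sum_range_id, Finset.sum_range_succ]
    rw [Nat.card_congr (TournamentOn.congr (finSuccEquiv n)),
      Nat.card_congr (TournamentOn.optionEquiv (Fin n)), Nat.card_prod, ih, h, pow_add]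
    simp [Nat.card_eq_fintype_card]

theorem card_tournamentOn {α : Type*} [Finite α] :
    Nat.card (TournamentOn α) = 2 ^ (Nat.card α * (Nat.card α - 1) / 2) := by
  rw [Nat.card_congr (TournamentOn.congr (Finite.equivFin α)), card_tournamentOn_fin]

/-- The set of vertices from which every vertex can be reached. -/
def TournamentOn.sources {α : Type*} (R : TournamentOn α) : Set α :=
  {v | ∀ u, Relation.ReflTransGen R.1 v u}

theorem TournamentOn.sources_nonempty {α : Type*} [Finite α] [Nonempty α] (R : TournamentOn α) :
    R.sources.Nonempty := by
  let r : α → α → Prop := fun a b => Relation.ReflTransGen R.1 b a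
  have : IsTrans α r := ⟨fun a b c h₁ h₂ => Relation.ReflTransGen.trans h₂ h₁⟩
  have hd : Directed r (id : α → α) := by
    intro a b
    by_cases hab : a = b
    · subst hab
      exact ⟨a, .refl, .refl⟩
    by_cases h : R.1 a b
    · exact ⟨a, .refl, .single h⟩
    · exact ⟨b, .single ((R.2.2 b a (Ne.symm hab)).2 h), .refl⟩
  obtain ⟨z, hz⟩ := hd.finite_le (id : α → α)
  exact ⟨z, hz⟩

/-- A nonempty set consists of the sources exactly when it dominates its complement and
induces a strongly connected subtournament. -/
theorem TournamentOn.sources_eq_iff {α : Type*} (R : TournamentOn α) {S : Set α}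
    (hS : S.Nonempty) :
    R.sources = S ↔ (∀ a ∈ S, ∀ b ∉ S, R.1 a b) ∧
      ∀ u v : S, Relation.ReflTransGen (fun a b : S => R.1 a b) u v := by
  constructor
  · rintro rfl
    refine ⟨fun a ha b hb => ?_, ?_⟩
    · refine (R.2.2 a b (by rintro rfl; exact hb ha)).2 fun h => hb fun u => ?_
      exact .head h (ha u)
    · rintro ⟨u, hu⟩ ⟨v, hv⟩
      have huv := hu v
      induction huv using Relation.ReflTransGen.head_induction_on with
      | refl => exact .refl
      | head h h' ih =>
        have hc := fun x => h'.trans (hv x)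
        exact .head (b := ⟨_, hc⟩) h (ih hc)
  · rintro ⟨hdom, hconn⟩
    apply Set.Subset.antisymm
    · intro b hb
      by_contra hbS
      obtain ⟨a, ha⟩ := hS
      have hba := hb a
      clear hb
      induction hba using Relation.ReflTransGen.head_induction_on with
      | refl => exact hbS ha
      | @head x y h h' ih =>
        refine ih fun hy => ?_
        exact (R.2.2 y x (by rintro rfl; exact hbS hy)).1 (hdom y hy x hbS) h
    · intro a ha u
      by_cases hu : u ∈ S
      · exact (hconn ⟨a, ha⟩ ⟨u, hu⟩).lift Subtype.val fun _ _ h => h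
      · exact .single (hdom a ha u hu)

/-- The tournament obtained from tournaments on `S` and on its complement by letting `S`
dominate its complement. -/
def TournamentOn.glue {α : Type*} {S : Set α} (A : TournamentOn S)
    (B : TournamentOn (Sᶜ : Set α)) : TournamentOn α :=
  ⟨fun u v => (∃ (hu : u ∈ S) (hv : v ∈ S), A.1 ⟨u, hu⟩ ⟨v, hv⟩) ∨ (u ∈ S ∧ v ∉ S) ∨
      ∃ (hu : u ∈ Sᶜ) (hv : v ∈ Sᶜ), B.1 ⟨u, hu⟩ ⟨v, hv⟩, by
    intro u
    by_cases hu : u ∈ S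
    · simpa [hu] using A.2.1 ⟨u, hu⟩
    · simpa [hu] using B.2.1 ⟨u, hu⟩, by
    intro u v huv
    by_cases hu : u ∈ S <;> by_cases hv : v ∈ S
    · simpa [hu, hv] using A.2.2 ⟨u, hu⟩ ⟨v, hv⟩ (by simpa using huv)
    · simp [hu, hv]
    · simp [hu, hv]
    · simpa [hu, hv] using B.2.2 ⟨u, hu⟩ ⟨v, hv⟩ (by simpa using huv)⟩

/-- Tournaments whose set of sources is `S` amount to a strongly connected tournament on `S`
and an arbitrary tournament on the complement. -/
def TournamentOn.sourcesFiberEquiv {α : Type*} {S : Set α} (hS : S.Nonempty) :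
    {R : TournamentOn α // R.sources = S} ≃
      StrongTournamentOn S × TournamentOn (Sᶜ : Set α) where
  toFun R := (⟨fun a b => R.1.1 a b, ⟨fun u => R.1.2.1 _,
      fun u v h => R.1.2.2 _ _ (Subtype.val_injective.ne h)⟩,
      ((R.1.sources_eq_iff hS).1 R.2).2⟩,
    ⟨fun a b => R.1.1 a b, fun u => R.1.2.1 _,
      fun u v h => R.1.2.2 _ _ (Subtype.val_injective.ne h)⟩)
  invFun p := ⟨glue ⟨p.1.1, p.1.2.1⟩ p.2, by
    refine (sources_eq_iff _ hS).2 ⟨fun a ha b hb => .inr (.inl ⟨ha, hb⟩), fun u v => ?_⟩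
    exact Relation.ReflTransGen.mono (fun a b h => .inl ⟨a.2, b.2, h⟩) _ _ (p.1.2.2 u v)⟩
  left_inv R := by
    have hdom := ((R.1.sources_eq_iff hS).1 R.2).1
    apply Subtype.ext
    apply Subtype.ext
    funext u v
    by_cases hu : u ∈ S <;> by_cases hv : v ∈ S
    · simp [glue, hu, hv]
    · simpa [glue, hu, hv] using hdom u hu v hv
    · have h := (R.1.2.2 v u (by rintro rfl; exact hu hv)).1 (hdom v hv u hu)
      simpa [glue, hu, hv] using h
    · simp [glue, hu, hv]
  right_inv p := by
    refine Prod.ext (Subtype.ext ?_) (Subtype.ext ?_)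
    · funext u v
      simp [glue]
    · funext u v
      have hu : (u : α) ∉ S := u.2
      have hv : (v : α) ∉ S := v.2
      simp [glue, hu, hv]

theorem card_sources_fiber {n : ℕ} (hn : 1 ≤ n) (S : Finset (Fin n)) :
    Nat.card {R : TournamentOn (Fin n) // R.sources = S} =
      if S.card = 0 then 0
      else w S.card * 2 ^ ((n - S.card) * (n - S.card - 1) / 2) := by
  split_ifs with h
  · have : Nonempty (Fin n) := ⟨⟨0, hn⟩⟩
    rw [Finset.card_eq_zero] at h
    subst h
    have : IsEmpty {R : TournamentOn (Fin n) // R.sources = ((∅ : Finset (Fin n)) : Set _)} :=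
      ⟨fun R => R.1.sources_nonempty.ne_empty (by simpa using R.2)⟩
    exact Nat.card_of_isEmpty
  · have hS : (S : Set (Fin n)).Nonempty := by
      simpa [Finset.nonempty_iff_ne_empty] using h
    have hc : Nat.card ((S : Set (Fin n))ᶜ : Set (Fin n)) = n - S.card := by
      rw [Nat.card_coe_set_eq, Set.ncard_compl, Set.ncard_coe_finset, Nat.card_fin]
    rw [Nat.card_congr (TournamentOn.sourcesFiberEquiv hS), Nat.card_prod,
      card_strongTournamentOn, card_tournamentOn, hc, Nat.card_coe_set_eq, Set.ncard_coe_finset]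

theorem two_pow_eq_sum_strong {n : ℕ} (hn : 1 ≤ n) :
    2 ^ (n * (n - 1) / 2) = ∑ s ∈ Finset.Ico 1 (n + 1),
      n.choose s * (w s * 2 ^ ((n - s) * (n - s - 1) / 2)) := by
  classical
  let f : TournamentOn (Fin n) → Finset (Fin n) := fun R => R.sources.toFinset
  have hf (S : Finset (Fin n)) : Nat.card {R // f R = S} =
      Nat.card {R : TournamentOn (Fin n) // R.sources = S} :=
    Nat.card_congr (Equiv.subtypeEquivRight fun R => by
      rw [← Finset.coe_inj, Set.coe_toFinset])
  rw [← card_tournamentOn_fin, ← Nat.card_congr (Equiv.sigmaFiberEquiv f), Nat.card_sigma]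
  simp only [hf, card_sources_fiber hn]
  rw [← Finset.powerset_univ, Finset.sum_powerset_apply_card
    (fun s => if s = 0 then 0 else w s * 2 ^ ((n - s) * (n - s - 1) / 2)),
    Finset.card_univ, Fintype.card_fin, Finset.range_eq_Ico,
    Finset.sum_eq_sum_Ico_succ_bot (by omega)]
  simp only [if_true, smul_zero, zero_add]
  refine Finset.sum_congr rfl fun s hs => ?_
  rw [if_neg (by have := (Finset.mem_Ico.1 hs).1; omega), smul_eq_mul]

/-- `w_0 = 1` and, for `n ≥ 1`,
`w_n = 2^(n(n-1)/2) − ∑_{s=1}^{n-1} (n choose s)·w_s·2^((n-s)(n-s-1)/2)`. -/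
theorem stmt_5 :
    w 0 = 1 ∧ ∀ n : ℕ, 1 ≤ n →
      (w n : ℤ) = 2 ^ (n * (n - 1) / 2)
        - ∑ s ∈ Finset.Ico 1 n,
            (n.choose s : ℤ) * w s * 2 ^ ((n - s) * (n - s - 1) / 2) := by
  refine ⟨?_, fun n hn => ?_⟩
  · have : Unique {R : Fin 0 → Fin 0 → Prop // IsTournament R ∧ StronglyConnected R} :=
      ⟨⟨⟨fun _ _ => False, ⟨fun u => u.elim0, fun u => u.elim0⟩, fun u => u.elim0⟩⟩,
        fun R => Subtype.ext (funext fun u => u.elim0)⟩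
    exact Nat.card_unique
  · have h := congrArg (Nat.cast : ℕ → ℤ) (two_pow_eq_sum_strong hn)
    rw [Finset.sum_Ico_succ_top hn] at h
    push_cast at h
    rw [h]
    simp [mul_assoc]
end

section
/- Let m,n ≥ 1, X = {1,...,m} × {1,...,n}, and P the partition of X into the blocks C_i = {i} × {1,...,n}. A transformation f = [f_1,...,f_m; f̄] ∈ T(X,P) is idempotent if and only if (i) f̄ is an idempotent of T_m, (ii) f_i is an idempotent of T_n for every i in the image of f̄, and (iii) the image of f_i is contained in the image of f_{i f̄} for every i ∈ {1,...,m} not in the image of f̄. -/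
/-- Let `m, n ≥ 1` and `X = {1,…,m} × {1,…,n}`, partitioned into the blocks
`C_i = {i} × {1,…,n}`.  A transformation `f = [f_1,…,f_m; f̄]` of `T(X,P)` (given by the data
`fb = f̄ : Fin m → Fin m` and components `fc i = f_i : Fin n → Fin n`, so that
`f (i,x) = (fb i, fc i x)`) is idempotent if and only if (i) `fb` is idempotent,
(ii) `fc i` is idempotent for every `i` in the image of `fb`, and (iii) the image of `fc i`
is contained in the image of `fc (fb i)` for every `i` not in the image of `fb`. -/
theorem stmt_9 (m n : ℕ) (hm : 1 ≤ m) (hn : 1 ≤ n)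
    (fb : Fin m → Fin m) (fc : Fin m → Fin n → Fin n)
    (f : Fin m × Fin n → Fin m × Fin n)
    (hf : ∀ p : Fin m × Fin n, f p = (fb p.1, fc p.1 p.2)) :
    f ∘ f = f ↔
      (fb ∘ fb = fb ∧
       (∀ i : Fin m, i ∈ Set.range fb → fc i ∘ fc i = fc i) ∧
       (∀ i : Fin m, i ∉ Set.range fb → Set.range (fc i) ⊆ Set.range (fc (fb i)))) := by
  have key : f ∘ f = f ↔
      ∀ i x, fb (fb i) = fb i ∧ fc (fb i) (fc i x) = fc i x := by
    simp [funext_iff, hf]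
  rw [key]
  constructor
  · intro h
    have hfb : ∀ i, fb (fb i) = fb i := fun i => (h i ⟨0, hn⟩).1
    refine ⟨funext hfb, ?_, ?_⟩
    · rintro _ ⟨k, rfl⟩
      funext x
      have hx := (h (fb k) x).2
      rwa [hfb k] at hx
    · rintro i - _ ⟨x, rfl⟩
      exact ⟨fc i x, (h i x).2⟩
  · rintro ⟨hfb, hidem, hrange⟩ i x
    refine ⟨congrFun hfb i, ?_⟩
    by_cases hi : i ∈ Set.range fb
    · obtain ⟨k, rfl⟩ := hi
      rw [show fb (fb k) = fb k from congrFun hfb k]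
      exact congrFun (hidem (fb k) ⟨k, rfl⟩) x
    · obtain ⟨y, hy⟩ := hrange i hi ⟨x, rfl⟩
      rw [← hy]
      exact congrFun (hidem (fb i) ⟨i, rfl⟩) y
end

section
/- Let m,n ≥ 1, X = {1,...,m} × {1,...,n}, and P the partition of X into the blocks C_i = {i} × {1,...,n}. Then the number of idempotents of T(X,P) equals ∑_{k=1}^{m} ∑_{a} multinomial(m; k, a_1,...,a_k) ∑_{l} ∏_{i=1}^{k} (n choose l_i) · l_i^{(a_i+1)n − l_i}, where the middle sum is over all k-tuples a = (a_1,...,a_k) of non-negative integers with a_1 + ⋯ + a_k = m − k, and the inner sum is over all l = (l_1,...,l_k) ∈ {1,...,n}^k. -/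
open Finset

theorem sum_piFinset_nonempty_card {τ κ M : Type*} [Fintype τ] [DecidableEq τ]
    [Fintype κ] [CommSemiring M] (h : (τ → ℕ) → M) :
    ∑ F ∈ Fintype.piFinset fun _ : τ => ({s | s.Nonempty} : Finset (Finset κ)),
        h (fun i => #(F i)) =
      ∑ l ∈ Fintype.piFinset fun _ : τ => Icc 1 (Fintype.card κ),
        (∏ i, ((Fintype.card κ).choose (l i) : M)) * h l := by
  rw [← sum_fiberwise_of_maps_to (g := fun F i => #(F i))
    (t := Fintype.piFinset fun _ : τ => Icc 1 (Fintype.card κ))]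
  · refine sum_congr rfl fun l hl => ?_
    have : (Fintype.piFinset fun _ : τ => ({s | s.Nonempty} : Finset (Finset κ))).filter
        (fun F => (fun i => #(F i)) = l) = Fintype.piFinset fun i => powersetCard (l i) univ := by
      ext F
      simp only [Fintype.mem_piFinset, mem_Icc] at hl
      simp only [mem_filter, Fintype.mem_piFinset, mem_univ, true_and, mem_powersetCard,
        subset_univ, funext_iff, and_iff_right_iff_imp]
      intro hF i
      exact card_pos.1 (hF i ▸ (hl i).1)
    rw [sum_congr rfl (g := fun _ => h l) (by
      intro F hF
      rw [(mem_filter.1 hF).2]), this, sum_const, Fintype.card_piFinset, nsmul_eq_mul]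
    simp
  · intro F hF
    simp only [Fintype.mem_piFinset, mem_filter, mem_univ, true_and, mem_Icc] at hF ⊢
    exact fun i => ⟨card_pos.2 (hF i), card_le_univ _⟩

variable {ι κ : Type*} [Fintype ι] [DecidableEq ι] [Fintype κ]

theorem sum_nonempty_support [Nonempty κ] {k : ℕ} {I : Finset ι} (hI : #I = k) :
    ∑ F : ι → Finset κ with ({i | (F i).Nonempty} : Finset ι) = I,
      ∏ i, (if (F i).Nonempty then #(F i) ^ (Fintype.card κ - #(F i))
        else ∑ j, #(F j) ^ Fintype.card κ) =
    ∑ F ∈ Fintype.piFinset fun _ : Fin k => ({s | s.Nonempty} : Finset (Finset κ)),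
      (∏ i, #(F i) ^ (Fintype.card κ - #(F i))) *
        (∑ j, #(F j) ^ Fintype.card κ) ^ (Fintype.card ι - k) := by
  let e : Fin k ≃ I := (I.equivFinOfCardEq hI).symm
  refine sum_nbij' (fun F i => F (e i)) (fun F i => if h : i ∈ I then F (e.symm ⟨i, h⟩) else ∅)
    ?_ ?_ ?_ ?_ ?_
  · intro F hF
    have hF := (mem_filter.1 hF).2
    simp only [Fintype.mem_piFinset, mem_filter, mem_univ, true_and]
    intro i
    exact (mem_filter.1 (hF.symm.subset (e i).2)).2
  · intro F hF
    simp only [Fintype.mem_piFinset, mem_filter, mem_univ, true_and] at hF ⊢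
    ext i
    by_cases hi : i ∈ I <;> simp [hi, hF]
  · intro F hF
    have hF := (mem_filter.1 hF).2
    ext1 i
    by_cases hi : i ∈ I
    · simp [hi]
    · have : ¬ (F i).Nonempty := fun h => hi (hF ▸ by simpa using h)
      simp [hi, not_nonempty_iff_eq_empty.1 this]
  · intro F _
    simp
  · intro F hF
    have hF := (mem_filter.1 hF).2
    have hsum : ∑ j, #(F j) ^ Fintype.card κ = ∑ j, #(F (e j)) ^ Fintype.card κ := by
      rw [e.sum_comp (fun j : I => #(F j) ^ Fintype.card κ),
        sum_coe_sort I (fun j => #(F j) ^ Fintype.card κ)]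
      refine (sum_subset (subset_univ I) fun j _ hj => ?_).symm
      have : F j = ∅ := not_nonempty_iff_eq_empty.1 fun h => hj (hF ▸ by simpa using h)
      simp [this]
    rw [prod_ite, hF, hsum, prod_const, filter_not, hF, card_univ_sdiff, hI,
      e.prod_comp (fun i : I => #(F i) ^ (Fintype.card κ - #(F i))),
      prod_coe_sort I (fun i => #(F i) ^ (Fintype.card κ - #(F i)))]

variable [DecidableEq κ]

/-- The points fixed by `f` inside the block indexed by `i`. -/
def fixedInBlock (f : ι × κ → ι × κ) (i : ι) : Finset κ := {x | f (i, x) = (i, x)}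

/-- The possible restrictions to block `i` of a block-preserving idempotent whose set of fixed
points in each block `j` is `F j`. -/
def idempotentBlockMaps (F : ι → Finset κ) (i : ι) : Finset (κ → ι × κ) :=
  if (F i).Nonempty then
    Fintype.piFinset fun x => if x ∈ F i then {(i, x)} else {i} ×ˢ F i
  else univ.biUnion fun j => Fintype.piFinset fun _ => {j} ×ˢ F j

theorem mem_idempotentBlockMaps_of_nonempty {F : ι → Finset κ} {i : ι} (hi : (F i).Nonempty)
    {g : κ → ι × κ} :
    g ∈ idempotentBlockMaps F i ↔
      ∀ x, (g x).1 = i ∧ (g x).2 ∈ F i ∧ (x ∈ F i → (g x).2 = x) := by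
  simp only [idempotentBlockMaps, if_pos hi, Fintype.mem_piFinset]
  refine forall_congr' fun x => ?_
  split_ifs with hx
  · simp only [mem_singleton, Prod.ext_iff, hx, true_implies]
    grind
  · simp only [mem_product, mem_singleton, hx, false_implies, and_true]

theorem mem_idempotentBlockMaps_of_not_nonempty {F : ι → Finset κ} {i : ι}
    (hi : ¬(F i).Nonempty) {g : κ → ι × κ} :
    g ∈ idempotentBlockMaps F i ↔ ∃ j, ∀ x, (g x).1 = j ∧ (g x).2 ∈ F j := by
  simp only [idempotentBlockMaps, if_neg hi, mem_biUnion, mem_univ, true_and,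
    Fintype.mem_piFinset, mem_product, mem_singleton]

theorem card_idempotentBlockMaps [Nonempty κ] (F : ι → Finset κ) (i : ι) :
    #(idempotentBlockMaps F i) =
      if (F i).Nonempty then #(F i) ^ (Fintype.card κ - #(F i))
      else ∑ j, #(F j) ^ Fintype.card κ := by
  unfold idempotentBlockMaps
  split_ifs with hi
  · rw [Fintype.card_piFinset]
    simp only [apply_ite Finset.card, card_singleton, card_product, one_mul]
    rw [prod_ite, prod_const_one, one_mul, prod_const, filter_not, filter_mem_eq_inter, univ_inter,
      card_univ_sdiff]
  · rw [card_biUnion]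
    · simp [Fintype.card_piFinset]
    · intro j _ j' _ hjj'
      refine disjoint_left.2 fun g hg hg' => hjj' ?_
      obtain ⟨x⟩ := ‹Nonempty κ›
      simp only [Fintype.mem_piFinset, mem_product, mem_singleton] at hg hg'
      rw [← (hg x).1, (hg' x).1]

theorem blockPreserving_idempotent_iff [Nonempty κ] (f : ι × κ → ι × κ) (F : ι → Finset κ) :
    (((∀ i, ∃ j, ∀ x, (f (i, x)).1 = j) ∧ f ∘ f = f) ∧ fixedInBlock f = F) ↔
      ∀ i, (fun x => f (i, x)) ∈ idempotentBlockMaps F i := by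
  constructor
  · rintro ⟨⟨hP, hf⟩, rfl⟩ i
    have hfix : ∀ y, (f y).2 ∈ fixedInBlock f (f y).1 := fun y => by
      simpa [fixedInBlock] using congrFun hf y
    obtain ⟨j, hj⟩ := hP i
    by_cases hi : (fixedInBlock f i).Nonempty
    · rw [mem_idempotentBlockMaps_of_nonempty hi]
      obtain ⟨z, hz⟩ := hi
      have hji : j = i := by
        rw [← hj z, (mem_filter.1 hz).2]
      intro x
      have hx1 : (f (i, x)).1 = i := (hj x).trans hji
      have hx2 := hfix (i, x)
      rw [hx1] at hx2
      exact ⟨hx1, hx2, fun hx => by rw [(mem_filter.1 hx).2]⟩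
    · rw [mem_idempotentBlockMaps_of_not_nonempty hi]
      refine ⟨j, fun x => ⟨hj x, ?_⟩⟩
      have hx := hfix (i, x)
      rwa [hj x] at hx
  · intro h
    have hmem : ∀ y, (f y).2 ∈ F (f y).1 := by
      rintro ⟨i, x⟩
      by_cases hi : (F i).Nonempty
      · have := (mem_idempotentBlockMaps_of_nonempty hi).1 (h i) x
        grind
      · obtain ⟨j, hj⟩ := (mem_idempotentBlockMaps_of_not_nonempty hi).1 (h i)
        grind
    have hfix : ∀ i, ∀ x ∈ F i, f (i, x) = (i, x) := fun i x hx => by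
      have := (mem_idempotentBlockMaps_of_nonempty ⟨x, hx⟩).1 (h i) x
      exact Prod.ext this.1 (this.2.2 hx)
    refine ⟨⟨fun i => ?_, funext fun y => hfix _ _ (hmem y)⟩, ?_⟩
    · by_cases hi : (F i).Nonempty
      · exact ⟨i, fun x => ((mem_idempotentBlockMaps_of_nonempty hi).1 (h i) x).1⟩
      · obtain ⟨j, hj⟩ := (mem_idempotentBlockMaps_of_not_nonempty hi).1 (h i)
        exact ⟨j, fun x => (hj x).1⟩
    · ext i x
      refine ⟨fun hx => ?_, fun hx => mem_filter.2 ⟨mem_univ _, hfix i x hx⟩⟩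
      simpa [(mem_filter.1 hx).2] using hmem (i, x)

theorem ncard_blockPreserving_idempotent [Nonempty κ] :
    {f : ι × κ → ι × κ | (∀ i, ∃ j, ∀ x, (f (i, x)).1 = j) ∧ f ∘ f = f}.ncard =
      ∑ F : ι → Finset κ, ∏ i, if (F i).Nonempty then #(F i) ^ (Fintype.card κ - #(F i))
        else ∑ j, #(F j) ^ Fintype.card κ := by
  classical
  rw [Set.ncard_eq_toFinset_card', card_eq_sum_card_fiberwise (f := fixedInBlock) (t := univ)
    (by simp)]
  refine sum_congr rfl fun F _ => ?_
  simp only [← card_idempotentBlockMaps]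
  rw [← Fintype.card_piFinset]
  refine card_equiv (Equiv.curry ι κ (ι × κ)) fun f => ?_
  simp only [mem_filter, Set.mem_toFinset, Set.mem_ofPred_eq, blockPreserving_idempotent_iff,
    Fintype.mem_piFinset]
  rfl

theorem multinomial_finCons {k s : ℕ} {a : Fin k → ℕ} (ha : ∑ i, a i = s) (c : ℕ) :
    Nat.multinomial univ (Fin.cons c a : Fin (k + 1) → ℕ) =
      (c + s).choose c * Nat.multinomial univ a := by
  subst ha
  rw [Fin.univ_succ, Nat.multinomial_cons]
  simp [Nat.multinomial, sum_map, prod_map]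


/-- For `m, n ≥ 1`, the number of idempotents of `T(X,P)` — the monoid of
transformations of `X = {1,…,m} × {1,…,n}` preserving the partition into blocks
`C_i = {i} × {1,…,n}` — equals
`∑_{k=1}^{m} ∑_{a} multinomial(m; k, a_1,…,a_k) ∑_{l} ∏_{i=1}^{k} (n choose l_i)·l_i^{(a_i+1)n − l_i}`,
where the middle sum is over all `k`-tuples `a` of non-negative integers with
`a_1 + ⋯ + a_k = m − k` and the inner sum is over all `l ∈ {1,…,n}^k`. -/
theorem stmt_10 (m n : ℕ) (hm : 1 ≤ m) (hn : 1 ≤ n) :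
    {f : Fin m × Fin n → Fin m × Fin n |
        (∀ i : Fin m, ∃ j : Fin m, ∀ x : Fin n, (f (i, x)).1 = j) ∧ f ∘ f = f}.ncard
      = ∑ k ∈ Finset.Icc 1 m, ∑ a ∈ Finset.Nat.antidiagonalTuple k (m - k),
          Nat.multinomial Finset.univ (Fin.cons k a) *
            ∑ l ∈ Fintype.piFinset (fun _ : Fin k => Finset.Icc 1 n),
              ∏ i : Fin k, n.choose (l i) * (l i) ^ ((a i + 1) * n - l i) := by
  have : Nonempty (Fin n) := ⟨⟨0, hn⟩⟩
  rw [ncard_blockPreserving_idempotent,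
    ← sum_fiberwise (g := fun F : Fin m → Finset (Fin n) => ({i | (F i).Nonempty} : Finset (Fin m))),
    sum_congr rfl fun I _ => sum_nonempty_support (I := I) rfl, ← powerset_univ,
    sum_powerset_apply_card fun k =>
      ∑ F ∈ Fintype.piFinset fun _ : Fin k => ({s | s.Nonempty} : Finset (Finset (Fin n))),
        (∏ i, #(F i) ^ (Fintype.card (Fin n) - #(F i))) *
          (∑ j, #(F j) ^ Fintype.card (Fin n)) ^ (Fintype.card (Fin m) - k)]
  simp only [card_univ, Fintype.card_fin, smul_eq_mul]
  have hIcc : Icc 1 m ⊆ range (m + 1) := fun k hk => by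
    simp only [mem_Icc, mem_range] at hk ⊢
    lia
  rw [← sum_subset hIcc]
  · refine sum_congr rfl fun k hk => ?_
    have hkm : k + (m - k) = m := by
      rw [mem_Icc] at hk
      lia
    have h := sum_piFinset_nonempty_card (κ := Fin n) (M := ℕ) fun l : Fin k → ℕ =>
      (∏ i, l i ^ (n - l i)) * (∑ j, l j ^ n) ^ (m - k)
    simp only [Fintype.card_fin, Nat.cast_id] at h
    rw [h]
    simp only [sum_pow_eq_sum_piAntidiag, piAntidiag_univ_fin_eq_antidiagonalTuple, mul_sum]
    rw [sum_comm]
    refine sum_congr rfl fun a ha => sum_congr rfl fun l hl => ?_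
    rw [multinomial_finCons (Nat.mem_antidiagonalTuple.1 ha), hkm]
    have hprod : ∏ i, n.choose (l i) * l i ^ ((a i + 1) * n - l i) =
        (∏ i, n.choose (l i)) * (∏ i, l i ^ (n - l i)) * ∏ i, (l i ^ n) ^ a i := by
      rw [← prod_mul_distrib, ← prod_mul_distrib]
      refine prod_congr rfl fun i _ => ?_
      have hln : l i ≤ n := (mem_Icc.1 (Fintype.mem_piFinset.1 hl i)).2
      have hexp : (a i + 1) * n - l i = n - l i + n * a i := by
        rw [add_mul, one_mul, mul_comm, Nat.add_sub_assoc hln, add_comm]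
      rw [hexp, pow_add, pow_mul, mul_assoc]
    rw [hprod, Nat.cast_id]
    ring
  · intro k _ hk
    obtain rfl : k = 0 := by
      simp only [mem_Icc, mem_range] at *
      lia
    simp [show m ≠ 0 by lia]
end

section
/- Let m,n ≥ 2, X = {1,...,m} × {1,...,n}, P the partition of X into blocks C_i = {i} × {1,...,n}, and let S = E(X,P) be the submonoid of T(X,P) generated by its idempotents. Define S_1 = {f ∈ T(X,P) : f̄ = 1 and f_1,...,f_m ∈ E_n}, S_2 = {f ∈ T(X,P) : f̄ ∈ T_m \ S_m}, and S_3 = {f ∈ T(X,P) : f̄ ∈ T_m \ S_m and f_1,...,f_m ∈ S_n}. Then S is the disjoint union of S_1 and S_2, and S_2 = S_1·S_3 (the set of products of an element of S_1 with an element of S_3); moreover S_1 is the internal direct product of m copies of E_n. -/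
/-- `BP f` says that `f : X → X`, with `X = {1,…,m} × {1,…,n}`, preserves the partition of
`X` into the blocks `C_i = {i} × {1,…,n}`, i.e. `f ∈ T(X,P)`. -/
def BP {m n : ℕ} (f : Fin m × Fin n → Fin m × Fin n) : Prop :=
  ∀ i : Fin m, ∃ j : Fin m, ∀ x : Fin n, (f (i, x)).1 = j

/-- `fbar hn f = f̄`, the induced transformation of `{1,…,m}` (for `f ∈ T(X,P)`). -/
def fbar {m n : ℕ} (hn : 0 < n) (f : Fin m × Fin n → Fin m × Fin n) (i : Fin m) : Fin m :=
  (f (i, ⟨0, hn⟩)).1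

/-- `comp' f i = f_i`, the `i`-th component of `f ∈ T(X,P)` acting on `{1,…,n}`. -/
def comp' {m n : ℕ} (f : Fin m × Fin n → Fin m × Fin n) (i : Fin m) (x : Fin n) : Fin n :=
  (f (i, x)).2

/-- `S_1 = {f ∈ T(X,P) : f̄ = 1, f_1,…,f_m ∈ E_n}`, where `E_n = {1} ∪ (T_n \ S_n)`. -/
def S1 (m n : ℕ) : Set (Function.End (Fin m × Fin n)) :=
  {f | BP f ∧ (∀ p : Fin m × Fin n, (f p).1 = p.1) ∧
      ∀ i : Fin m, comp' f i = id ∨ ¬ Function.Bijective (comp' f i)}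

/-- `S_2 = {f ∈ T(X,P) : f̄ ∈ T_m \ S_m}`. -/
def S2 {m n : ℕ} (hn : 0 < n) : Set (Function.End (Fin m × Fin n)) :=
  {f | BP f ∧ ¬ Function.Bijective (fbar hn f)}

/-- `S_3 = {f ∈ T(X,P) : f̄ ∈ T_m \ S_m, f_1,…,f_m ∈ S_n}`. -/
def S3 {m n : ℕ} (hn : 0 < n) : Set (Function.End (Fin m × Fin n)) :=
  {f | BP f ∧ ¬ Function.Bijective (fbar hn f) ∧
      ∀ i : Fin m, Function.Bijective (comp' f i)}

/-- The map assembling components `c : Fin m → (Fin n → Fin n)` into the element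
`[c_1,…,c_m; 1]` of `T(X,P)`. -/
def phi (m n : ℕ) (c : Fin m → Fin n → Fin n) : Function.End (Fin m × Fin n) :=
  fun p => (p.1, c p.1 p.2)

/-- Howie's argument for a wreath product with a group `G`: a property of pairs
`(f, c)` that is closed under composition and holds for the idempotents moving one point `i` to
another point `j` with label `a` holds for all pairs `(f, c)` with `f` singular. -/
theorem wreath_singular_induction {ι G : Type*} [Fintype ι] [DecidableEq ι] [Group G]
    (P : (ι → ι) → (ι → G) → Prop)
    (base : ∀ i j a, i ≠ j → P (Function.update id i j) (Pi.mulSingle i a))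
    (mul : ∀ f c g d, P f c → P g d → P (f ∘ g) (fun x => c (g x) * d x))
    (f : ι → ι) (c : ι → G) (hf : ¬ Function.Surjective f) : P f c := by
  have move : ∀ g : ι → ι, (∀ d, P g d) → ∀ i j, i ≠ j →
      ∀ d, P (Function.update id i j ∘ g) d := by
    intro g hg i j hij d
    simpa using mul _ _ _ _ (base i j 1 hij) (hg d)
  have swap_comp : ∀ g : ι → ι, (∀ d, P g d) → ¬ Function.Surjective g → ∀ x y, x ≠ y →
      ∀ d, P (Equiv.swap x y ∘ g) d := by
    intro g hg hs x y hxy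
    obtain ⟨k, hk⟩ : ∃ k, ∀ z, g z ≠ k := by simpa [Function.Surjective] using hs
    by_cases hkx : k = x
    · subst hkx
      convert move g hg y k hxy.symm using 2
      ext z
      have := hk z
      simp only [Function.comp, Function.update_apply, Equiv.swap_apply_def, id]
      grind
    by_cases hky : k = y
    · subst hky
      convert move g hg x k hxy using 2
      ext z
      have := hk z
      simp only [Function.comp, Function.update_apply, Equiv.swap_apply_def, id]
      grind
    convert move _ (move _ (move g hg x k (Ne.symm hkx)) y x hxy.symm) k y hky using 2
    ext z
    have := hk z
    simp only [Function.comp, Function.update_apply, Equiv.swap_apply_def, id]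
    grind
  have perm_comp : ∀ (σ : Equiv.Perm ι) (g : ι → ι), (∀ d, P g d) → ¬ Function.Surjective g →
      ∀ d, P (σ ∘ g) d := by
    intro σ g hg hs
    induction σ using Equiv.Perm.swap_induction_on with
    | one => simpa using hg
    | swap_mul τ x y hxy ih =>
      refine swap_comp (τ ∘ g) ih ?_ x y hxy
      rwa [τ.comp_surjective]
  have relabel_range : ∀ (u : ι) (e : ι → ι), (∀ x, e x ≠ u) →
      ∀ b d : ι → G, P e d → P e (fun x => b (e x) * d x) := by
    intro u e he b
    let H : Submonoid (ι → G) :=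
      { carrier := {b | ∀ d, P e d → P e (fun x => b (e x) * d x)}
        one_mem' := fun d hd => by simpa only [Pi.one_apply, one_mul] using hd
        mul_mem' := fun {a b} ha hb d hd => by
          simpa only [Pi.mul_apply, mul_assoc] using ha _ (hb d hd) }
    suffices hb : b ∈ H from hb
    refine Submonoid.pi_mem_of_mulSingle_mem b fun i d hd => ?_
    by_cases hi : i = u
    · subst hi
      simpa only [Pi.mulSingle_eq_of_ne (he _), one_mul] using hd
    · have h := mul _ _ _ _ (base u i 1 (Ne.symm hi)) (mul _ _ _ _ (base i u (b i) hi) hd)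
      have hfun : Function.update id u i ∘ Function.update id i u ∘ e = e := by
        ext x
        have := he x
        simp only [Function.comp, Function.update_apply, id]
        split_ifs <;> simp_all
      rw [hfun] at h
      simpa only [Pi.mulSingle_one, Pi.one_apply, one_mul] using h
  have relabel : ∀ u v d, u ≠ v → P (Function.update id u v) d := by
    intro u v d huv
    have he : ∀ x, Function.update id u v x ≠ u := by
      intro x
      by_cases hx : x = u
      · simp [hx, huv.symm]
      · simp [hx]
    have key := relabel_range u _ he d _ (base u v ((d v)⁻¹ * d u) huv)
    have hd : (fun x => d (Function.update id u v x) *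
        Pi.mulSingle (M := fun _ => G) u ((d v)⁻¹ * d u) x) = d := by
      ext x
      by_cases hx : x = u
      · subst hx
        simp
      · simp [hx]
    rwa [hd] at key
  induction hr : (Finset.univ \ Finset.univ.image f).card using Nat.strong_induction_on
    generalizing f c with
  | _ r ih =>
  obtain ⟨k, hk⟩ : ∃ k, ∀ z, f z ≠ k := by simpa [Function.Surjective] using hf
  obtain ⟨u, v, huv, hne⟩ : ∃ u v, f u = f v ∧ u ≠ v := by
    simpa [Function.Injective] using mt Finite.injective_iff_surjective.mp hf
  let f' := Function.update f u k
  have hcomp : f' ∘ Function.update id u v = f := by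
    ext x
    simp only [f', Function.comp, Function.update_apply, id]
    grind
  by_cases hs : Function.Surjective f'
  · have hb : Function.Bijective f' := ⟨Finite.injective_iff_surjective.mpr hs, hs⟩
    have := perm_comp (Equiv.ofBijective f' hb) (Function.update id u v)
      (fun d => relabel u v d hne) (fun h => by
        obtain ⟨x, hx⟩ := h u
        simp only [Function.update_apply, id] at hx
        grind) c
    rwa [Equiv.coe_ofBijective, hcomp] at this
  · have hlt : (Finset.univ \ Finset.univ.image f').card < r := by
      rw [← hr]
      refine Finset.card_lt_card (Finset.ssubset_iff_of_subset ?_ |>.mpr ⟨k, ?_, ?_⟩)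
      · intro y hy
        simp only [Finset.mem_sdiff, Finset.mem_univ, true_and, Finset.mem_image,
          not_exists] at hy ⊢
        intro x hx
        by_cases hxu : x = u
        · refine hy v ?_
          simp only [f', Function.update_apply]
          grind
        · refine hy x ?_
          simp [f', hxu, hx]
      · simpa using hk
      · simpa using ⟨u, by simp [f']⟩
    have := mul _ _ _ _ (ih _ hlt f' c hs rfl) (base u v ((c v)⁻¹ * c u) hne)
    rw [hcomp] at this
    convert this using 1
    ext x
    by_cases hx : x = u
    · subst hx
      simp
    · simp [hx]

/-- The submonoid `E(X,P)` generated by the idempotents of `T(X,P)`. -/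
def idempotentClosure (m n : ℕ) : Submonoid (Function.End (Fin m × Fin n)) :=
  Submonoid.closure {f | BP f ∧ f * f = f}

/-- `phi` as a monoid homomorphism. -/
def phiHom (m n : ℕ) : (Fin m → Function.End (Fin n)) →* Function.End (Fin m × Fin n) where
  toFun := phi m n
  map_one' := rfl
  map_mul' _ _ := rfl

theorem BP.apply_eq {m n : ℕ} (hn : 0 < n) {f : Fin m × Fin n → Fin m × Fin n} (hf : BP f)
    (p : Fin m × Fin n) : f p = (fbar hn f p.1, comp' f p.1 p.2) := by
  obtain ⟨j, hj⟩ := hf p.1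
  ext1
  · exact (hj p.2).trans (hj _).symm
  · rfl

theorem BP.mul {m n : ℕ} {f g : Function.End (Fin m × Fin n)} (hf : BP f) (hg : BP g) :
    BP (f * g) := by
  intro i
  obtain ⟨j, hj⟩ := hg i
  obtain ⟨k, hk⟩ := hf j
  refine ⟨k, fun x => ?_⟩
  rw [← hk (g (i, x)).2, ← hj x]
  rfl

theorem fbar_mul {m n : ℕ} (hn : 0 < n) {f : Function.End (Fin m × Fin n)} (hf : BP f)
    (g : Function.End (Fin m × Fin n)) : fbar hn (f * g) = fbar hn f ∘ fbar hn g := by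
  ext1 i
  change (f (g (i, ⟨0, hn⟩))).1 = _
  rw [hf.apply_eq hn]
  rfl

theorem fbar_eq_id {m n : ℕ} (hn : 0 < n) {f : Function.End (Fin m × Fin n)}
    (hf : f ∈ S1 m n) : fbar hn f = id :=
  funext fun _ => hf.2.1 _

theorem S1_eq_phi {m n : ℕ} {f : Function.End (Fin m × Fin n)} (hf : f ∈ S1 m n) :
    phi m n (comp' f) = f :=
  funext fun p => Prod.ext (hf.2.1 p).symm rfl

theorem phi_mem_S1 {m n : ℕ} {c : Fin m → Fin n → Fin n}
    (hc : ∀ i, c i = id ∨ ¬ Function.Bijective (c i)) : phi m n c ∈ S1 m n :=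
  ⟨fun i => ⟨i, fun _ => rfl⟩, fun _ => rfl, hc⟩

theorem not_bijective_comp {α : Type*} [Finite α] {f g : α → α}
    (h : ¬ Function.Bijective f ∨ ¬ Function.Bijective g) : ¬ Function.Bijective (f ∘ g) := by
  intro hfg
  have hg : Function.Bijective g := Finite.injective_iff_bijective.mp hfg.1.of_comp
  have hf : Function.Bijective f := Finite.surjective_iff_bijective.mp hfg.2.of_comp
  tauto

theorem S1_mul_mem {m n : ℕ} {f g : Function.End (Fin m × Fin n)} (hf : f ∈ S1 m n)
    (hg : g ∈ S1 m n) : f * g ∈ S1 m n := by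
  rw [← S1_eq_phi hf, ← S1_eq_phi hg]
  refine phi_mem_S1 (c := fun i => comp' f i ∘ comp' g i) fun i => ?_
  rcases hf.2.2 i with h | h
  · rw [h]
    exact hg.2.2 i
  · exact Or.inr (not_bijective_comp (Or.inl h))

theorem mul_mem_S2 {m n : ℕ} (hn : 0 < n) {f g : Function.End (Fin m × Fin n)} (hf : BP f)
    (hg : BP g) (h : f ∈ S2 hn ∨ g ∈ S2 hn) : f * g ∈ S2 hn :=
  ⟨hf.mul hg, by
    rw [fbar_mul hn hf]
    exact not_bijective_comp (h.imp And.right And.right)⟩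

theorem eq_id_of_comp_self {α : Type*} {f : α → α} (hf : Function.Injective f)
    (h : f ∘ f = f) : f = id :=
  funext fun x => hf (congrFun h x)

theorem idempotent_mem {m n : ℕ} (hn : 0 < n) {f : Function.End (Fin m × Fin n)} (hf : BP f)
    (h : f * f = f) : f ∈ S1 m n ∪ S2 hn := by
  by_cases hb : Function.Bijective (fbar hn f)
  · left
    have hid : fbar hn f = id := eq_id_of_comp_self hb.1 (by rw [← fbar_mul hn hf, h])
    have hfst : ∀ p, (f p).1 = p.1 := fun p => by rw [hf.apply_eq hn, hid]; rfl
    refine ⟨hf, hfst, fun i => or_iff_not_imp_right.mpr fun hi => ?_⟩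
    refine eq_id_of_comp_self (not_not.mp hi).1 (funext fun x => ?_)
    have h1 : f (i, x) = (i, comp' f i x) := Prod.ext (hfst _) rfl
    have h2 : f (f (i, x)) = f (i, x) := congrFun h (i, x)
    exact congrArg Prod.snd ((congrArg f h1).symm.trans h2)
  · exact Or.inr ⟨hf, hb⟩

theorem idempotentClosure_le {m n : ℕ} (hn : 0 < n) {f : Function.End (Fin m × Fin n)}
    (hf : f ∈ idempotentClosure m n) : f ∈ S1 m n ∪ S2 hn := by
  induction hf using Submonoid.closure_induction with
  | mem f hf => exact idempotent_mem hn hf.1 hf.2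
  | one => exact Or.inl (phi_mem_S1 (c := fun _ => id) fun _ => Or.inl rfl)
  | mul f g _ _ hf hg =>
    have hBf : BP f := hf.elim And.left And.left
    have hBg : BP g := hg.elim And.left And.left
    rcases hf with hf | hf
    · rcases hg with hg | hg
      · exact Or.inl (S1_mul_mem hf hg)
      · exact Or.inr (mul_mem_S2 hn hBf hBg (Or.inr hg))
    · exact Or.inr (mul_mem_S2 hn hBf hBg (Or.inl hf))

theorem phi_mulSingle_mem {m n : ℕ} (i : Fin m) (g : Function.End (Fin n))
    (hg : ¬ Function.Bijective g) :
    phiHom m n (Pi.mulSingle i g) ∈ idempotentClosure m n := by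
  let K : Submonoid (Function.End (Fin n)) := (idempotentClosure m n).comap
    ((phiHom m n).comp (MonoidHom.mulSingle (fun _ => Function.End (Fin n)) i))
  have idem_mem : ∀ e : Function.End (Fin n), e * e = e → e ∈ K := fun e he =>
    Submonoid.subset_closure ⟨fun k => ⟨k, fun _ => rfl⟩, by rw [← map_mul, he]⟩
  refine wreath_singular_induction (G := Unit)
    (fun f _ => (show Function.End (Fin n) from f) ∈ K)
    ?_ (fun _ _ _ _ hf hg => K.mul_mem hf hg) g 1 (mt Finite.surjective_iff_bijective.mp hg)
  intro x y _ hxy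
  refine idem_mem _ (funext fun z => ?_)
  change Function.update id x y (Function.update id x y z) = Function.update id x y z
  simp only [Function.update_apply, id]
  split_ifs <;> simp_all

theorem S1_subset_idempotentClosure {m n : ℕ} {f : Function.End (Fin m × Fin n)}
    (hf : f ∈ S1 m n) : f ∈ idempotentClosure m n := by
  rw [← S1_eq_phi hf]
  refine Submonoid.pi_mem_of_mulSingle_mem (H := (idempotentClosure m n).comap (phiHom m n))
    (f := fun _ => Function.End (Fin n)) (comp' f) fun i => ?_
  rcases hf.2.2 i with h | h
  · have h1 : comp' f i = (1 : Function.End (Fin n)) := h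
    rw [h1, Pi.mulSingle_one]
    exact one_mem ((idempotentClosure m n).comap (phiHom m n))
  · exact phi_mulSingle_mem i _ h

theorem S3_subset_idempotentClosure {m n : ℕ} (hn : 0 < n) {f : Function.End (Fin m × Fin n)}
    (hf : f ∈ S3 hn) : f ∈ idempotentClosure m n := by
  obtain ⟨hB, hs, hc⟩ := hf
  have key := wreath_singular_induction (G := Equiv.Perm (Fin n))
    (fun (g : Fin m → Fin m) c =>
      (fun p => (g p.1, c p.1 p.2) : Function.End (Fin m × Fin n)) ∈ idempotentClosure m n)
    ?_ ?_ (fbar hn f) (fun i => Equiv.ofBijective _ (hc i))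
    (mt Finite.surjective_iff_bijective.mp hs)
  · rwa [show f = _ from funext fun p => hB.apply_eq hn p]
  · intro i j a hij
    refine Submonoid.subset_closure ⟨fun k => ⟨Function.update id i j k, fun _ => rfl⟩, ?_⟩
    funext p
    let c : Fin m → Equiv.Perm (Fin n) := Pi.mulSingle i a
    change (Function.update id i j (Function.update id i j p.1),
      c (Function.update id i j p.1) (c p.1 p.2)) = (Function.update id i j p.1, c p.1 p.2)
    by_cases hp : p.1 = i
    · simp [c, hp, hij.symm]
    · simp [c, hp]
  · intro g c h d hg hh
    exact mul_mem hg hh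

theorem exists_bijective_comp {α : Type*} (g : α → α) :
    ∃ b a : α → α, Function.Bijective b ∧ (a = id ∨ ¬ Function.Bijective a) ∧ b ∘ a = g := by
  by_cases hg : Function.Bijective g
  · exact ⟨g, id, hg, Or.inl rfl, rfl⟩
  · exact ⟨id, g, Function.bijective_id, Or.inr hg, rfl⟩

theorem S2_eq_mul {m n : ℕ} (hn : 0 < n) :
    S2 hn = {h : Function.End (Fin m × Fin n) | ∃ a ∈ S1 m n, ∃ b ∈ S3 hn, h = b * a} := by
  ext h
  constructor
  · rintro ⟨hB, hs⟩
    choose b a hb ha hba using fun i => exists_bijective_comp (comp' h i)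
    refine ⟨phi m n a, phi_mem_S1 ha, fun p => (fbar hn h p.1, b p.1 p.2),
      ⟨fun i => ⟨fbar hn h i, fun _ => rfl⟩, hs, hb⟩, funext fun p => ?_⟩
    rw [hB.apply_eq hn, ← hba]
    rfl
  · rintro ⟨a, ha, b, hb, rfl⟩
    exact mul_mem_S2 hn hb.1 ha.1 (Or.inl ⟨hb.1, hb.2.1⟩)

/-- For `m, n ≥ 2`, the submonoid `S = E(X,P)` of `T(X,P)` generated by its
idempotents is the disjoint union of `S_1` and `S_2`; moreover `S_2 = S_1·S_3` (products of
an element of `S_1` by an element of `S_3`, in that order), and `S_1` is the internal direct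
product of `m` copies of `E_n` (via the multiplicative bijection `phi`). -/
theorem stmt_12 (m n : ℕ) (hm : 2 ≤ m) (hn : 2 ≤ n) :
    ((Submonoid.closure {f : Function.End (Fin m × Fin n) | BP f ∧ f * f = f} :
        Set (Function.End (Fin m × Fin n)))
      = S1 m n ∪ S2 (show 0 < n by omega)) ∧
    (S1 m n ∩ S2 (show 0 < n by omega) = ∅) ∧
    (S2 (show 0 < n by omega)
      = {h : Function.End (Fin m × Fin n) |
          ∃ a ∈ S1 m n, ∃ b ∈ S3 (show 0 < n by omega), h = b * a}) ∧
    (∀ c d : Fin m → Fin n → Fin n,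
      phi m n (fun i => c i ∘ d i) = phi m n c * phi m n d) ∧
    Set.BijOn (phi m n)
      {c : Fin m → Fin n → Fin n | ∀ i, c i = id ∨ ¬ Function.Bijective (c i)}
      (S1 m n) := by
  refine ⟨?_, ?_, S2_eq_mul _, fun _ _ => rfl, fun c hc => phi_mem_S1 hc, ?_,
    fun f hf => ⟨comp' f, hf.2.2, S1_eq_phi hf⟩⟩
  · refine Set.Subset.antisymm (fun f hf => idempotentClosure_le _ hf) (fun f hf => ?_)
    rcases hf with hf | hf
    · exact S1_subset_idempotentClosure hf
    · rw [S2_eq_mul] at hf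
      obtain ⟨a, ha, b, hb, rfl⟩ := hf
      exact (idempotentClosure m n).mul_mem (S3_subset_idempotentClosure _ hb)
        (S1_subset_idempotentClosure ha)
  · refine Set.eq_empty_of_forall_notMem fun f hf => hf.2.2 ?_
    rw [fbar_eq_id _ hf.1]
    exact Function.bijective_id
  · intro c _ d _ h
    funext i x
    exact congrArg Prod.snd (congrFun h (i, x))
end

section
/- Let m,n ≥ 2, X = {1,...,m} × {1,...,n}, P the partition of X into blocks C_i = {i} × {1,...,n}, and S = E(X,P) the submonoid of T(X,P) generated by its idempotents. Then the cardinality of S is (n^n − n! + 1)^m + n^{mn}·(m^m − m!). -/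
/-- The block-preserving map acting on block indices by `p` and on the `i`-th block by `g i`. -/
def blockMap {ι κ : Type*} (p : ι → ι) (g : ι → κ → κ) : Function.End (ι × κ) :=
  fun z => (p z.1, g z.1 z.2)

/-- The monoid generated by the idempotent block-preserving maps. -/
def idemMonoid (ι κ : Type*) : Submonoid (Function.End (ι × κ)) :=
  Submonoid.closure {f | (∃ p g, f = blockMap p g) ∧ f * f = f}

section

variable {ι κ : Type*}

theorem blockMap_mul (p q : ι → ι) (g k : ι → κ → κ) :
    blockMap p g * blockMap q k = blockMap (p ∘ q) (fun i => g (q i) ∘ k i) := rfl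

theorem blockMap_injective [Nonempty κ] :
    Function.Injective (fun w : (ι → ι) × (ι → κ → κ) => blockMap w.1 w.2) := by
  rintro ⟨p, g⟩ ⟨q, k⟩ h
  have h' : ∀ i x, p i = q i ∧ g i x = k i x := fun i x => by
    simpa [blockMap] using congrFun h (i, x)
  refine Prod.ext (funext fun i => (h' i (Classical.arbitrary κ)).1) ?_
  exact funext fun i => funext fun x => (h' i x).2

theorem blockMap_mem_of_idem {p : ι → ι} {g : ι → κ → κ} (hp : ∀ i, p (p i) = p i)
    (hg : ∀ i x, g (p i) (g i x) = g i x) : blockMap p g ∈ idemMonoid ι κ :=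
  Submonoid.subset_closure ⟨⟨p, g, rfl⟩, funext fun z => Prod.ext (hp z.1) (hg z.1 z.2)⟩

/-- Moves block `a` onto block `b` through `k`, and fixes the other blocks. -/
def blockMove [DecidableEq ι] (a b : ι) (k : κ → κ) : Function.End (ι × κ) :=
  blockMap (fun i => if i = a then b else i) (fun i => if i = a then k else id)

theorem blockMove_mem [DecidableEq ι] {a b : ι} (h : a ≠ b) (k : κ → κ) :
    blockMove a b k ∈ idemMonoid ι κ := by
  apply blockMap_mem_of_idem
  · intro i
    grind
  · intro i x
    by_cases hi : i = a <;> simp [hi, h.symm]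

/-- The elements that map the set of non-block-surjective members of the idempotent-generated
monoid into itself under left multiplication. -/
def holeStabilizer (ι κ : Type*) : Submonoid (Function.End (ι × κ)) where
  carrier := {u | ∀ f ∈ idemMonoid ι κ, (∃ h, ∀ z, (f z).1 ≠ h) →
    u * f ∈ idemMonoid ι κ ∧ ∃ h, ∀ z, ((u * f) z).1 ≠ h}
  one_mem' := fun f hf h => by rw [one_mul]; exact ⟨hf, h⟩
  mul_mem' := fun {u v} hu hv f hf h => by
    have h1 := hv f hf h
    rw [mul_assoc]
    exact hu _ h1.1 h1.2

/-- Block permutations acting as the identity on the fibres. -/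
def permHom (ι κ : Type*) : Equiv.Perm ι →* Function.End (ι × κ) where
  toFun p := blockMap p (fun _ => id)
  map_one' := rfl
  map_mul' _ _ := rfl

/-- Families of self-maps of the fibres, acting blockwise. -/
def fibreHom (ι κ : Type*) : (ι → Function.End κ) →* Function.End (ι × κ) where
  toFun g := blockMap id g
  map_one' := rfl
  map_mul' _ _ := rfl

theorem permHom_apply (p : Equiv.Perm ι) (z : ι × κ) : permHom ι κ p z = (p z.1, z.2) := rfl

theorem blockMove_apply [DecidableEq ι] (a b : ι) (k : κ → κ) (z : ι × κ) :
    blockMove a b k z = (if z.1 = a then b else z.1, if z.1 = a then k z.2 else z.2) := by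
  by_cases h : z.1 = a <;> simp [blockMove, blockMap, h]

theorem blockMove_blockMove [DecidableEq ι] {a b : ι} {z : ι × κ} (hz : z.1 ≠ b) (k : κ → κ) :
    blockMove b a id (blockMove a b k z) = (z.1, if z.1 = a then k z.2 else z.2) := by
  by_cases h : z.1 = a <;> simp [blockMove_apply, h, hz]

theorem permHom_mem_holeStabilizer [Finite ι] (p : Equiv.Perm ι) :
    permHom ι κ p ∈ holeStabilizer ι κ := by
  classical
  have key : (⊤ : Submonoid (Equiv.Perm ι)) ≤ (holeStabilizer ι κ).comap (permHom ι κ) := by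
    rw [← Equiv.Perm.mclosure_isSwap, Submonoid.closure_le]
    rintro _ ⟨x, y, hxy, rfl⟩ f hf ⟨h, hh⟩
    refine ⟨?_, Equiv.swap x y h, fun z hz => hh z ((Equiv.swap x y).injective hz)⟩
    by_cases hx : x = h
    · have : permHom ι κ (Equiv.swap x y) * f = blockMove y x id * f := by
        funext z
        have := hh z
        change permHom ι κ _ (f z) = blockMove y x id (f z)
        simp only [permHom_apply, blockMove_apply, Equiv.swap_apply_def]
        grind
      rw [this]
      exact mul_mem (blockMove_mem hxy.symm _) hf
    by_cases hy : y = h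
    · have : permHom ι κ (Equiv.swap x y) * f = blockMove x y id * f := by
        funext z
        have := hh z
        change permHom ι κ _ (f z) = blockMove x y id (f z)
        simp only [permHom_apply, blockMove_apply, Equiv.swap_apply_def]
        grind
      rw [this]
      exact mul_mem (blockMove_mem hxy _) hf
    have : permHom ι κ (Equiv.swap x y) * f =
        blockMove h y id * (blockMove y x id * (blockMove x h id * f)) := by
      funext z
      have := hh z
      change permHom ι κ _ (f z) = blockMove h y id (blockMove y x id (blockMove x h id (f z)))
      simp only [permHom_apply, blockMove_apply, Equiv.swap_apply_def]
      grind
    rw [this]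
    exact mul_mem (blockMove_mem (Ne.symm hy) _)
      (mul_mem (blockMove_mem hxy.symm _) (mul_mem (blockMove_mem hx _) hf))
  exact key (Submonoid.mem_top p)

theorem fibreHom_mem_holeStabilizer [Finite ι] (g : ι → Function.End κ) :
    fibreHom ι κ g ∈ holeStabilizer ι κ := by
  classical
  refine Submonoid.pi_mem_of_mulSingle_mem (H := (holeStabilizer ι κ).comap (fibreHom ι κ)) g ?_
  rintro x f hf ⟨h, hh⟩
  refine ⟨?_, h, hh⟩
  by_cases hx : x = h
  · have : fibreHom ι κ (Pi.mulSingle x (g x)) * f = f := by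
      funext z
      have := hh z
      refine Prod.ext rfl ?_
      change (Pi.mulSingle x (g x) : ι → Function.End κ) (f z).1 (f z).2 = (f z).2
      rw [Pi.mulSingle_eq_of_ne (by grind)]
      rfl
    rwa [this]
  have : fibreHom ι κ (Pi.mulSingle x (g x)) * f =
      blockMove h x id * (blockMove x h (g x) * f) := by
    funext z
    have hz := hh z
    refine Eq.trans ?_ (blockMove_blockMove hz (g x)).symm
    refine Prod.ext rfl ?_
    change (Pi.mulSingle x (g x) : ι → Function.End κ) (f z).1 (f z).2 = _
    by_cases hzx : (f z).1 = x
    · rw [hzx, Pi.mulSingle_eq_same, if_pos rfl]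
    · rw [Pi.mulSingle_eq_of_ne hzx, if_neg hzx]
      rfl
  rw [this]
  exact mul_mem (blockMove_mem (Ne.symm hx) _) (mul_mem (blockMove_mem hx _) hf)

/-- A self-map of a finite type is an idempotent followed by a permutation. -/
theorem exists_perm_comp_idem [Finite ι] (p : ι → ι) :
    ∃ (σ : Equiv.Perm ι) (e : ι → ι), (∀ i, e (e i) = e i) ∧ ∀ i, σ (e i) = p i := by
  classical
  have := Fintype.ofFinite ι
  let s : ι → ι := fun j => if h : ∃ i, p i = j then h.choose else j
  have hs : ∀ i, p (s (p i)) = p i := fun i => by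
    have h : ∃ j, p j = p i := ⟨i, rfl⟩
    simp only [s, dif_pos h]
    exact h.choose_spec
  have hinj : Set.InjOn p (Set.range (s ∘ p)) := by
    rintro _ ⟨i, rfl⟩ _ ⟨j, rfl⟩ h
    simp only [Function.comp, hs] at h ⊢
    rw [h]
  obtain ⟨σ, hσ⟩ := Set.MapsTo.exists_equiv_extend_of_card_eq (t := Finset.univ) (f := p)
    (by simp) (Set.mapsTo_iff_image_subset.2 (by simp)) hinj
  refine ⟨σ.trans (Equiv.subtypeUnivEquiv (by simp)), s ∘ p, fun i => ?_, fun i => ?_⟩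
  · simp only [Function.comp, hs]
  · simpa [hs] using hσ (s (p i)) ⟨i, rfl⟩

theorem blockMap_mem_of_bijective [Finite ι] {p : ι → ι} (hp : ¬ Function.Injective p)
    (g : ι → Equiv.Perm κ) : blockMap p (fun i => g i) ∈ idemMonoid ι κ := by
  obtain ⟨σ, e, he, hσ⟩ := exists_perm_comp_idem p
  have hmem : blockMap e (fun i => (g (e i)).symm ∘ g i) ∈ idemMonoid ι κ :=
    blockMap_mem_of_idem he fun i x => by simp [he]
  have hhole : ∃ h, ∀ i, e i ≠ h := by
    by_contra! h
    apply hp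
    have h1 : Function.Injective e := Finite.injective_iff_surjective.2 h
    intro i j hij
    rw [← hσ, ← hσ] at hij
    exact h1 (σ.injective hij)
  obtain ⟨h, hh⟩ := hhole
  have key := (mul_mem (permHom_mem_holeStabilizer σ)
    (fibreHom_mem_holeStabilizer (fun i => (g i : κ → κ))) _ hmem ⟨h, fun z => hh z.1⟩).1
  convert key using 1
  funext z
  exact Prod.ext (hσ z.1).symm ((g (e z.1)).apply_symm_apply _).symm

/-- **Howie's theorem**: a non-bijective self-map of a finite type is a product of idempotents. -/
theorem mem_closure_idem_of_not_injective [Finite ι] {p : Function.End ι}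
    (hp : ¬ Function.Injective p) :
    p ∈ Submonoid.closure {f : Function.End ι | f * f = f} := by
  let φ : Function.End (ι × Unit) →* Function.End ι :=
    { toFun := fun f i => (f (i, ())).1
      map_one' := rfl
      map_mul' := fun _ _ => rfl }
  have hle : idemMonoid ι Unit ≤ (Submonoid.closure {f : Function.End ι | f * f = f}).comap φ := by
    rw [idemMonoid, Submonoid.closure_le]
    rintro f ⟨-, hf⟩
    exact Submonoid.subset_closure (by simp [← map_mul, hf])
  exact hle (blockMap_mem_of_bijective hp fun _ => 1)

theorem fibreHom_mem_idemMonoid [Finite ι] [Finite κ] {g : ι → Function.End κ}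
    (hg : ∀ i, g i = 1 ∨ ¬ Function.Injective (g i)) : fibreHom ι κ g ∈ idemMonoid ι κ := by
  classical
  refine Submonoid.pi_mem_of_mulSingle_mem (H := (idemMonoid ι κ).comap (fibreHom ι κ)) g ?_
  intro i
  obtain h | h := hg i
  · simp [h]
  have hle : Submonoid.closure {f : Function.End κ | f * f = f} ≤
      (idemMonoid ι κ).comap
        ((fibreHom ι κ).comp (MonoidHom.mulSingle (fun _ => Function.End κ) i)) := by
    rw [Submonoid.closure_le]
    intro f hf
    exact Submonoid.subset_closure ⟨⟨_, _, rfl⟩, by rw [← map_mul, hf.out]⟩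
  exact hle (mem_closure_idem_of_not_injective h)

theorem blockMap_mem_of_not_injective [Finite ι] [Finite κ] {p : ι → ι}
    (hp : ¬ Function.Injective p) (g : ι → κ → κ) : blockMap p g ∈ idemMonoid ι κ := by
  classical
  let d : ι → Function.End κ := fun i => if Function.Injective (g i) then 1 else g i
  let b : ι → Equiv.Perm κ := fun i =>
    if h : Function.Injective (g i) then
      Equiv.ofBijective (g i) (Finite.injective_iff_bijective.1 h) else 1
  have hd : fibreHom ι κ d ∈ idemMonoid ι κ := by
    apply fibreHom_mem_idemMonoid
    intro i
    by_cases h : Function.Injective (g i) <;> simp [d, h]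
  convert mul_mem (blockMap_mem_of_bijective hp b) hd using 1
  funext ⟨i, x⟩
  change (p i, g i x) = (p i, b i (d i x))
  by_cases h : Function.Injective (g i) <;> simp [b, d, h, Function.End.one_def]

theorem coe_idemMonoid [Finite ι] [Finite κ] [Nonempty κ] :
    (idemMonoid ι κ : Set (Function.End (ι × κ))) =
      (fun w : (ι → ι) × (ι → κ → κ) => blockMap w.1 w.2) ''
        (({id} ×ˢ {g | ∀ i, g i ∈ ({id} ∪ {k | ¬ Function.Injective k} : Set (κ → κ))}) ∪
          ({p | ¬ Function.Injective p} ×ˢ Set.univ)) := by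
  apply Set.Subset.antisymm
  · intro f hf
    refine Submonoid.closure_induction ?_ ?_ ?_ hf
    · rintro _ ⟨⟨p, g, rfl⟩, hpg⟩
      refine ⟨(p, g), ?_, rfl⟩
      rw [blockMap_mul] at hpg
      have h := Prod.ext_iff.1 (blockMap_injective (a₁ := (_, _)) (a₂ := (_, _)) hpg)
      by_cases hp : Function.Injective p
      · have hid : p = id := funext fun i => hp (congrFun h.1 i)
        subst hid
        refine Or.inl ⟨rfl, fun i => ?_⟩
        by_cases hg : Function.Injective (g i)
        · exact Or.inl (funext fun x => hg (congrFun (congrFun h.2 i) x))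
        · exact Or.inr hg
      · exact Or.inr ⟨hp, trivial⟩
    · exact ⟨(id, fun _ => id), Or.inl ⟨rfl, fun _ => Or.inl rfl⟩, rfl⟩
    · rintro _ _ - - ⟨⟨p, g⟩, h1, rfl⟩ ⟨⟨q, k⟩, h2, rfl⟩
      refine ⟨(p ∘ q, fun i => g (q i) ∘ k i), ?_, rfl⟩
      rcases h2 with ⟨hq, hk⟩ | ⟨hq, -⟩
      · obtain rfl : q = id := hq
        rcases h1 with ⟨hp, hg⟩ | ⟨hp, -⟩
        · obtain rfl : p = id := hp
          refine Or.inl ⟨rfl, fun i => ?_⟩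
          rcases hk i with hki | hki
          · have hki' : k i = id := hki
            simpa [hki'] using hg i
          · exact Or.inr fun h => hki (Function.Injective.of_comp (f := g i) h)
        · exact Or.inr ⟨hp, trivial⟩
      · exact Or.inr ⟨fun h => hq (Function.Injective.of_comp (f := p) h), trivial⟩
  · rintro _ ⟨⟨p, g⟩, ⟨hp, hg⟩ | ⟨hp, -⟩, rfl⟩
    · obtain rfl : p = id := hp
      exact fibreHom_mem_idemMonoid hg
    · exact blockMap_mem_of_not_injective hp g

end

theorem ncard_not_injective (n : ℕ) :
    ({p : Fin n → Fin n | ¬ Function.Injective p}.ncard : ℤ) = (n : ℤ) ^ n - n.factorial := by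
  have h := Set.ncard_add_ncard_compl {p : Fin n → Fin n | Function.Injective p}
  have h1 : {p : Fin n → Fin n | Function.Injective p}.ncard = n.factorial := by
    rw [← Nat.card_coe_set_eq, Set.coe_ofPred,
      Nat.card_congr (Equiv.subtypeInjectiveEquivEmbedding (Fin n) (Fin n))]
    simp [Fintype.card_embedding_eq, Nat.descFactorial_self]
  rw [h1, Nat.card_eq_fintype_card, Fintype.card_fun, Fintype.card_fin, Set.compl_ofPred] at h
  rw [eq_sub_iff_add_eq, add_comm]
  exact_mod_cast h

theorem ncard_forall_mem {m : ℕ} {α : Type*} (s : Set α) :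
    {g : Fin m → α | ∀ i, g i ∈ s}.ncard = s.ncard ^ m := by
  rw [← Nat.card_coe_set_eq, ← Nat.card_coe_set_eq, Set.coe_ofPred,
    Nat.card_congr (Equiv.subtypePiEquivPi (p := fun _ a => a ∈ s)), Nat.card_pi]
  simp

/-- For `m, n ≥ 2`, the cardinality of the submonoid `S = E(X,P)` of
`T(X,P)` generated by its idempotents equals `(n^n − n! + 1)^m + n^{mn}·(m^m − m!)`. -/
theorem stmt_13 (m n : ℕ) (hm : 2 ≤ m) (hn : 2 ≤ n) :
    (((Submonoid.closure {f : Function.End (Fin m × Fin n) | BP f ∧ f * f = f} :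
        Set (Function.End (Fin m × Fin n))).ncard : ℤ)
      = ((n : ℤ) ^ n - (n.factorial : ℤ) + 1) ^ m
        + (n : ℤ) ^ (m * n) * ((m : ℤ) ^ m - (m.factorial : ℤ))) := by
  have : NeZero n := ⟨by omega⟩
  have hBP : ∀ f : Function.End (Fin m × Fin n), BP f ↔ ∃ p g, f = blockMap p g := fun f => by
    constructor
    · intro h
      choose p hp using h
      exact ⟨p, fun i x => (f (i, x)).2, funext fun z => Prod.ext (hp z.1 z.2) rfl⟩
    · rintro ⟨p, g, rfl⟩ i
      exact ⟨p i, fun _ => rfl⟩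
  simp only [hBP]
  change ((idemMonoid (Fin m) (Fin n) : Set (Function.End (Fin m × Fin n))).ncard : ℤ) = _
  rw [coe_idemMonoid, Set.ncard_image_of_injective _ blockMap_injective, Set.ncard_union_eq,
    Set.ncard_prod, Set.ncard_prod, ncard_forall_mem, Set.ncard_union_eq, Set.ncard_singleton,
    Set.ncard_singleton, Set.ncard_univ]
  · push_cast
    rw [ncard_not_injective, ncard_not_injective]
    simp only [Nat.card_eq_fintype_card, Fintype.card_fun, Fintype.card_fin]
    push_cast
    ring
  · exact Set.disjoint_singleton_left.2 fun h => h Function.injective_id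
  · refine Set.disjoint_left.2 ?_
    rintro ⟨p, g⟩ ⟨hp, -⟩ ⟨hp', -⟩
    obtain rfl : p = id := hp
    exact hp' Function.injective_id
end
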